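/- arXiv:2009.02595 — 12 statements merged into one kernel-verified Lean document; each statement's English description precedes it below -/
import Mathlib

section
/- Let n, r ≥ 1, let T be a finite index set, and for each t ∈ T let τ_t be a permutation of Fin n and a_t ∈ Matrix (Fin r) (Fin r) ℂ. Let A be the complex matrix indexed by (Fin n) × (Fin r) given by A = Σ_{t ∈ T} P_{τ_t} ⊗ a_t, and let U be the subspace of (Fin n × Fin r → ℂ) consisting of all x with Σ_{u ∈ Fin n} x(u,j) = 0 for every j ∈ Fin r. Then (a) the linear map determined by A maps U into U, and (b) the characteristic polynomial of A equals the characteristic polynomial of the r×r matrix Σ_{t ∈ T} a_t multiplied by the characteristic polynomial of the restriction of A to U. (This is the multiset spectrum identity spec(A_n(𝔏_n,p)) = spec(A_1(p)) ∪ spec(A_{n,⊥}(𝔏_n,p)) for lifts of matrix polynomials: the 'trivial eigenvalues' of a lift are exactly the eigenvalues of the 1-lift.) -/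
/-- If `L` embeds `V` as a complement of the `f`-invariant submodule `U` and intertwines `g` with
`f`, then the characteristic polynomial of `f` factors through `g` and the restriction to `U`. -/
theorem LinearMap.charpoly_eq_mul_charpoly_restrict {K V E : Type*} [Field K]
    [AddCommGroup V] [Module K V] [FiniteDimensional K V]
    [AddCommGroup E] [Module K E] [FiniteDimensional K E]
    (f : Module.End K E) (g : Module.End K V) (L : V →ₗ[K] E) (hL : f ∘ₗ L = L ∘ₗ g)
    (U : Submodule K E) (hf : ∀ x ∈ U, f x ∈ U)
    (hbij : Function.Bijective (L.coprod U.subtype)) :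
    f.charpoly = g.charpoly * (f.restrict hf).charpoly := by
  rw [← LinearMap.charpoly_prodMap,
    ← LinearEquiv.charpoly_conj (LinearEquiv.ofBijective _ hbij)]
  congr 1
  refine LinearMap.ext fun x => ?_
  obtain ⟨⟨v, u⟩, rfl⟩ := (LinearEquiv.ofBijective _ hbij).surjective x
  have h := LinearMap.congr_fun hL v
  simp only [LinearMap.comp_apply] at h
  rw [LinearEquiv.conj_apply_apply, LinearEquiv.symm_apply_apply]
  simp [h]

/-- For a matrix-polynomial lift `A = ∑ₜ P_{τ_t} ⊗ a_t`, the subspace `U`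
of vectors whose `Fin n`-sums vanish in every coordinate-block is invariant under `A`, and
`charpoly A = charpoly (∑ₜ a_t) * charpoly (A restricted to U)`:
the multiset identity `spec(A_n(𝔏_n,p)) = spec(A_1(p)) ∪ spec(A_{n,⊥}(𝔏_n,p))`. -/
theorem stmt_0 (n r : ℕ) (hn : 1 ≤ n) (hr : 1 ≤ r) (T : Type) [Fintype T]
    (τ : T → Equiv.Perm (Fin n)) (a : T → Matrix (Fin r) (Fin r) ℂ)
    (A : Matrix (Fin n × Fin r) (Fin n × Fin r) ℂ)
    (hA : ∀ (v : Fin n) (i : Fin r) (u : Fin n) (j : Fin r),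
      A (v, i) (u, j) = ∑ t : T, (if v = τ t u then (1 : ℂ) else 0) * a t i j)
    (U : Submodule ℂ (Fin n × Fin r → ℂ))
    (hU : ∀ x : Fin n × Fin r → ℂ, x ∈ U ↔ ∀ j : Fin r, ∑ u : Fin n, x (u, j) = 0) :
    ∃ hmap : ∀ x ∈ U, A.mulVecLin x ∈ U,
      A.charpoly = (∑ t : T, a t).charpoly *
        LinearMap.charpoly (A.mulVecLin.restrict hmap) := by
  have hn0 : (n : ℂ) ≠ 0 := Nat.cast_ne_zero.mpr (by omega)
  have hcol (i : Fin r) (u : Fin n) (j : Fin r) : ∑ v, A (v, i) (u, j) = (∑ t, a t) i j := by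
    simp only [hA, Matrix.sum_apply]
    rw [Finset.sum_comm]
    simp
  have hrow (v : Fin n) (i j : Fin r) : ∑ u, A (v, i) (u, j) = (∑ t, a t) i j := by
    simp only [hA, Matrix.sum_apply, ← Equiv.symm_apply_eq]
    rw [Finset.sum_comm]
    simp
  have hmap : ∀ x ∈ U, A.mulVecLin x ∈ U := by
    intro x hx
    rw [hU] at hx ⊢
    intro i
    simp only [Matrix.mulVecLin_apply, Matrix.mulVec, dotProduct]
    rw [Finset.sum_comm]
    simp_rw [← Finset.sum_mul, Fintype.sum_prod_type, hcol]
    rw [Finset.sum_comm]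
    simp [← Finset.mul_sum, hx]
  refine ⟨hmap, ?_⟩
  rw [← Matrix.charpoly_mulVecLin, ← Matrix.charpoly_mulVecLin]
  refine LinearMap.charpoly_eq_mul_charpoly_restrict _ _ (LinearMap.funLeft ℂ ℂ Prod.snd) ?_ U hmap
    ⟨?_, fun x => ?_⟩
  · refine LinearMap.ext fun c => funext fun ⟨v, i⟩ => ?_
    simp only [LinearMap.comp_apply, LinearMap.funLeft_apply, Matrix.mulVecLin_apply,
      Matrix.mulVec, dotProduct, Fintype.sum_prod_type]
    rw [Finset.sum_comm]
    simp_rw [← Finset.sum_mul, hrow]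
  · rw [injective_iff_map_eq_zero]
    rintro ⟨c, x, hx⟩ h
    have hcx (u : Fin n) (j : Fin r) : c j + x (u, j) = 0 := congr_fun h (u, j)
    have hc : c = 0 := by
      funext j
      have hsum : ∑ u : Fin n, (c j + x (u, j)) = 0 := Finset.sum_eq_zero fun u _ => hcx u j
      rw [Finset.sum_add_distrib, (hU x).mp hx j] at hsum
      simpa [hn0, Nat.ne_of_gt hn] using hsum
    subst hc
    ext p
    · rfl
    · simpa using hcx p.1 p.2
  · let c : Fin r → ℂ := fun j => (n : ℂ)⁻¹ * ∑ u, x (u, j)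
    refine ⟨(c, ⟨x - LinearMap.funLeft ℂ ℂ Prod.snd c, (hU _).mpr fun j => ?_⟩), ?_⟩
    · simp [c, LinearMap.funLeft_apply, hn0]
    · simp
end

section
/- Let n, r ≥ 1 and T a finite index set; for each t ∈ T let σ_t be a permutation of Fin n, s_t : Fin n → Bool, and a_t ∈ Matrix (Fin r) (Fin r) ℂ. Define the permutation ρ_t of Bool × Fin n by ρ_t(b,u) = (xor b (s_t u), σ_t u). Let A₂ := Σ_t P_{ρ_t} ⊗ a_t (a matrix indexed by (Bool × Fin n) × Fin r), A := Σ_t P_{σ_t} ⊗ a_t, and A_χ := Σ_t Q_t ⊗ a_t, where Q_t is the signed permutation matrix with (Q_t)_{v,u} = (−1 if s_t(u) else 1) when v = σ_t(u) and 0 otherwise. Then the characteristic polynomial of A₂ equals the product of the characteristic polynomials of A and A_χ; equivalently, spec(A₂) = spec(A) ∪ spec(A_χ) as multisets. (This is the spectrum identity for the product of an n-lift of a matrix polynomial with edge-signing 2-lifts: spec(A_{2n}(𝔗₂⊗𝔏_n, p)) = spec(A_n(𝔏_n,p)) ∪ spec(A_n(χ𝔏_n,p)).) -/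
open Matrix

/-- The characteristic polynomial of the symmetric block matrix with diagonal blocks `P` and
off-diagonal blocks `M` is the product of those of `P + M` and `P - M`. -/
theorem Matrix.charpoly_fromBlocks_swap {R m : Type*} [CommRing R] [Fintype m] [DecidableEq m]
    (P M : Matrix m m R) :
    (fromBlocks P M M P).charpoly = (P + M).charpoly * (P - M).charpoly := by
  let U : (Matrix (m ⊕ m) (m ⊕ m) R)ˣ :=
    { val := fromBlocks 1 0 1 1
      inv := fromBlocks 1 0 (-1) 1
      val_inv := by simp [fromBlocks_multiply]
      inv_val := by simp [fromBlocks_multiply] }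
  have h : U⁻¹.val * fromBlocks P M M P * U.val = fromBlocks (P + M) M 0 (P - M) := by
    change fromBlocks 1 0 (-1) 1 * fromBlocks P M M P * fromBlocks 1 0 1 1 = _
    simp only [fromBlocks_multiply]
    congr 1 <;> simp <;> abel
  rw [← charpoly_units_conj' U, ← coe_units_inv, h, charpoly_fromBlocks_zero₂₁]

/-- Spectrum identity for a 2-lift (edge-signing) of an `n`-lift of a matrix
polynomial: with `ρ_t (b,u) = (xor b (s_t u), σ_t u)`, the characteristic polynomial of
`A₂ = ∑ₜ P_{ρ_t} ⊗ a_t` is the product of those of `A = ∑ₜ P_{σ_t} ⊗ a_t` and of the signed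
matrix `A_χ = ∑ₜ Q_t ⊗ a_t`; i.e.
`spec(A_{2n}(𝔗₂⊗𝔏_n, p)) = spec(A_n(𝔏_n,p)) ∪ spec(A_n(χ𝔏_n,p))` as multisets. -/
theorem stmt_1 (n r : ℕ) (hn : 1 ≤ n) (hr : 1 ≤ r) (T : Type) [Fintype T]
    (σ : T → Equiv.Perm (Fin n)) (s : T → Fin n → Bool)
    (a : T → Matrix (Fin r) (Fin r) ℂ)
    (A₂ : Matrix ((Bool × Fin n) × Fin r) ((Bool × Fin n) × Fin r) ℂ)
    (hA₂ : ∀ (b' : Bool) (v : Fin n) (i : Fin r) (b : Bool) (u : Fin n) (j : Fin r),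
      A₂ ((b', v), i) ((b, u), j) =
        ∑ t : T, (if (b', v) = (Bool.xor b (s t u), σ t u) then (1 : ℂ) else 0) * a t i j)
    (A : Matrix (Fin n × Fin r) (Fin n × Fin r) ℂ)
    (hA : ∀ (v : Fin n) (i : Fin r) (u : Fin n) (j : Fin r),
      A (v, i) (u, j) = ∑ t : T, (if v = σ t u then (1 : ℂ) else 0) * a t i j)
    (Aχ : Matrix (Fin n × Fin r) (Fin n × Fin r) ℂ)
    (hAχ : ∀ (v : Fin n) (i : Fin r) (u : Fin n) (j : Fin r),
      Aχ (v, i) (u, j) =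
        ∑ t : T, (if v = σ t u then (if s t u then (-1 : ℂ) else 1) else 0) * a t i j) :
    A₂.charpoly = A.charpoly * Aχ.charpoly := by
  let e : (Bool × Fin n) × Fin r ≃ (Fin n × Fin r) ⊕ (Fin n × Fin r) :=
    (Equiv.prodAssoc _ _ _).trans (Equiv.boolProdEquivSum _)
  let P : Matrix (Fin n × Fin r) (Fin n × Fin r) ℂ :=
    of fun x y => A₂ ((false, x.1), x.2) ((false, y.1), y.2)
  let M : Matrix (Fin n × Fin r) (Fin n × Fin r) ℂ :=
    of fun x y => A₂ ((true, x.1), x.2) ((false, y.1), y.2)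
  have hblocks : reindex e e A₂ = fromBlocks P M M P := by
    ext (⟨v, i⟩ | ⟨v, i⟩) (⟨u, j⟩ | ⟨u, j⟩) <;>
      simp [e, P, M, Equiv.boolProdEquivSum, hA₂]
  have hadd : P + M = A := by
    ext ⟨v, i⟩ ⟨u, j⟩
    simp only [P, M, Matrix.add_apply, of_apply, hA₂, hA, ← Finset.sum_add_distrib]
    refine Finset.sum_congr rfl fun t _ => ?_
    cases s t u <;> simp
  have hsub : P - M = Aχ := by
    ext ⟨v, i⟩ ⟨u, j⟩
    simp only [P, M, Matrix.sub_apply, of_apply, hA₂, hAχ, ← Finset.sum_sub_distrib]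
    refine Finset.sum_congr rfl fun t _ => ?_
    cases s t u <;> by_cases h : v = σ t u <;> simp [h]
  rw [← charpoly_reindex e A₂, hblocks, charpoly_fromBlocks_swap, hadd, hsub]
end

section
/- In the setting of the 2-lift spectrum identity (with A₂ = Σ_t P_{ρ_t} ⊗ a_t on (Bool × Fin n) × Fin r, A = Σ_t P_{σ_t} ⊗ a_t on Fin n × Fin r, and A_χ = Σ_t Q_t ⊗ a_t the signed matrix), let U₂ be the subspace of ((Bool × Fin n) × Fin r → ℂ) of all x with Σ_{(b,u)} x((b,u),j) = 0 for every j, and U the subspace of (Fin n × Fin r → ℂ) of all x with Σ_u x(u,j) = 0 for every j. Then A₂ maps U₂ into U₂, A maps U into U, and the characteristic polynomial of the restriction of A₂ to U₂ equals the characteristic polynomial of the restriction of A to U multiplied by the characteristic polynomial of A_χ. (This is the identity spec(A_{2n,⊥}(𝔗₂⊗𝔏_n, p)) = spec(A_{n,⊥}(𝔏_n,p)) ∪ spec(A_n(χ𝔏_n,p)): the nontrivial spectrum of a 2-lifted adjacency matrix is the nontrivial spectrum of the base together with the full spectrum of the signed adjacency matrix.) -/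
open Matrix

/-- Pairs of a vector on the fibre sums and a vector on the fibre differences correspond
linearly to vectors on the doubled index set. -/
noncomputable def boolLiftEquiv (α β : Type*) :
    ((Bool × α) × β → ℂ) ≃ₗ[ℂ] (α × β → ℂ) × (α × β → ℂ) where
  toFun x := (fun q => x ((false, q.1), q.2) + x ((true, q.1), q.2),
    fun q => x ((false, q.1), q.2) - x ((true, q.1), q.2))
  map_add' x y := by
    ext q <;> simp only [Pi.add_apply, Prod.fst_add, Prod.snd_add] <;> ring
  map_smul' c x := by
    ext q <;> simp only [Pi.smul_apply, Prod.smul_fst, Prod.smul_snd, smul_eq_mul,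
      RingHom.id_apply] <;> ring
  invFun y p := if p.1.1 then (y.1 (p.1.2, p.2) - y.2 (p.1.2, p.2)) / 2
    else (y.1 (p.1.2, p.2) + y.2 (p.1.2, p.2)) / 2
  left_inv x := by
    ext ⟨⟨b, u⟩, j⟩
    cases b <;> simp
  right_inv y := by
    ext ⟨u, j⟩ <;> simp <;> ring

/-- A matrix on the doubled index set whose block sums and signed block differences are `A`
and `B` is conjugated by `boolLiftEquiv` to the block-diagonal map of `A` and `B`. -/
lemma boolLiftEquiv_mulVec {α β : Type*} [Fintype α] [Fintype β]
    (M : Matrix ((Bool × α) × β) ((Bool × α) × β) ℂ) (A B : Matrix (α × β) (α × β) ℂ)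
    (hA : ∀ v i b u j, M ((false, v), i) ((b, u), j) + M ((true, v), i) ((b, u), j) =
      A (v, i) (u, j))
    (hB : ∀ v i b u j, M ((false, v), i) ((b, u), j) - M ((true, v), i) ((b, u), j) =
      (if b then -1 else 1) * B (v, i) (u, j))
    (x : (Bool × α) × β → ℂ) :
    boolLiftEquiv α β (M *ᵥ x) =
      (A *ᵥ (boolLiftEquiv α β x).1, B *ᵥ (boolLiftEquiv α β x).2) := by
  ext ⟨v, i⟩ <;>
    simp only [boolLiftEquiv, LinearEquiv.coe_mk, LinearMap.coe_mk, AddHom.coe_mk, mulVec,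
      dotProduct, Fintype.sum_prod_type, Fintype.sum_bool, ← Finset.sum_add_distrib,
      ← Finset.sum_sub_distrib] <;>
    refine Finset.sum_congr rfl fun u _ => Finset.sum_congr rfl fun j _ => ?_
  · linear_combination x ((false, u), j) * hA v i false u j + x ((true, u), j) * hA v i true u j
  · have hf := hB v i false u j
    have ht := hB v i true u j
    simp only [if_true, Bool.false_eq_true, if_false] at hf ht
    linear_combination x ((false, u), j) * hf + x ((true, u), j) * ht

/-- If the column sums of every block of `A` do not depend on the column, then `A` preserves
the vectors with vanishing sums. -/
lemma sum_mulVec_eq_zero {α β : Type*} [Fintype α] [Fintype β]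
    (A : Matrix (α × β) (α × β) ℂ) (c : β → β → ℂ)
    (hc : ∀ i u j, ∑ v, A (v, i) (u, j) = c i j) (x : α × β → ℂ)
    (hx : ∀ j, ∑ u, x (u, j) = 0) (i : β) : ∑ v, (A *ᵥ x) (v, i) = 0 := by
  simp only [mulVec, dotProduct]
  rw [Finset.sum_comm]
  simp only [← Finset.sum_mul, Fintype.sum_prod_type, hc]
  rw [Finset.sum_comm]
  simp only [← Finset.mul_sum, hx, mul_zero, Finset.sum_const_zero]

/-- Nontrivial-spectrum identity for a 2-lift of an `n`-lift of a matrix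
polynomial: `A₂`, `A` preserve the respective "sum-zero" subspaces `U₂`, `U`, and
`charpoly (A₂|_{U₂}) = charpoly (A|_U) * charpoly A_χ`; i.e.
`spec(A_{2n,⊥}(𝔗₂⊗𝔏_n, p)) = spec(A_{n,⊥}(𝔏_n,p)) ∪ spec(A_n(χ𝔏_n,p))`. -/
theorem stmt_2 (n r : ℕ) (hn : 1 ≤ n) (hr : 1 ≤ r) (T : Type) [Fintype T]
    (σ : T → Equiv.Perm (Fin n)) (s : T → Fin n → Bool)
    (a : T → Matrix (Fin r) (Fin r) ℂ)
    (A₂ : Matrix ((Bool × Fin n) × Fin r) ((Bool × Fin n) × Fin r) ℂ)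
    (hA₂ : ∀ (b' : Bool) (v : Fin n) (i : Fin r) (b : Bool) (u : Fin n) (j : Fin r),
      A₂ ((b', v), i) ((b, u), j) =
        ∑ t : T, (if (b', v) = (Bool.xor b (s t u), σ t u) then (1 : ℂ) else 0) * a t i j)
    (A : Matrix (Fin n × Fin r) (Fin n × Fin r) ℂ)
    (hA : ∀ (v : Fin n) (i : Fin r) (u : Fin n) (j : Fin r),
      A (v, i) (u, j) = ∑ t : T, (if v = σ t u then (1 : ℂ) else 0) * a t i j)
    (Aχ : Matrix (Fin n × Fin r) (Fin n × Fin r) ℂ)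
    (hAχ : ∀ (v : Fin n) (i : Fin r) (u : Fin n) (j : Fin r),
      Aχ (v, i) (u, j) =
        ∑ t : T, (if v = σ t u then (if s t u then (-1 : ℂ) else 1) else 0) * a t i j)
    (U₂ : Submodule ℂ ((Bool × Fin n) × Fin r → ℂ))
    (hU₂ : ∀ x : (Bool × Fin n) × Fin r → ℂ,
      x ∈ U₂ ↔ ∀ j : Fin r, ∑ p : Bool × Fin n, x (p, j) = 0)
    (U : Submodule ℂ (Fin n × Fin r → ℂ))
    (hU : ∀ x : Fin n × Fin r → ℂ, x ∈ U ↔ ∀ j : Fin r, ∑ u : Fin n, x (u, j) = 0) :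
    ∃ (h₂ : ∀ x ∈ U₂, A₂.mulVecLin x ∈ U₂) (h : ∀ x ∈ U, A.mulVecLin x ∈ U),
      LinearMap.charpoly (A₂.mulVecLin.restrict h₂) =
        LinearMap.charpoly (A.mulVecLin.restrict h) * Aχ.charpoly := by
  have hplus : ∀ v i b u j, A₂ ((false, v), i) ((b, u), j) + A₂ ((true, v), i) ((b, u), j) =
      A (v, i) (u, j) := by
    intro v i b u j
    rw [hA₂, hA₂, hA, ← Finset.sum_add_distrib]
    refine Finset.sum_congr rfl fun t _ => ?_
    by_cases hv : v = σ t u <;> cases b <;> cases hs : s t u <;> simp [hv]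
  have hminus : ∀ v i b u j, A₂ ((false, v), i) ((b, u), j) - A₂ ((true, v), i) ((b, u), j) =
      (if b then -1 else 1) * Aχ (v, i) (u, j) := by
    intro v i b u j
    rw [hA₂, hA₂, hAχ, ← Finset.sum_sub_distrib, Finset.mul_sum]
    refine Finset.sum_congr rfl fun t _ => ?_
    by_cases hv : v = σ t u <;> cases b <;> cases hs : s t u <;> simp [hv]
  have hconj := boolLiftEquiv_mulVec A₂ A Aχ hplus hminus
  have hmem : ∀ x, x ∈ U₂ ↔ (boolLiftEquiv (Fin n) (Fin r) x).1 ∈ U := by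
    intro x
    simp only [hU₂, hU, boolLiftEquiv, LinearEquiv.coe_mk, LinearMap.coe_mk, AddHom.coe_mk,
      Fintype.sum_prod_type, Fintype.sum_bool, Finset.sum_add_distrib]
    exact forall_congr' fun j => by rw [add_comm]
  have h : ∀ x ∈ U, A.mulVecLin x ∈ U := by
    intro x hx
    rw [hU] at hx ⊢
    refine sum_mulVec_eq_zero A (fun i j => ∑ t, a t i j) (fun i u j => ?_) x hx
    simp only [hA]
    rw [Finset.sum_comm]
    simp
  have h₂ : ∀ x ∈ U₂, A₂.mulVecLin x ∈ U₂ := by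
    intro x hx
    rw [hmem, mulVecLin_apply, hconj]
    exact h _ ((hmem x).1 hx)
  refine ⟨h₂, h, ?_⟩
  let e : U₂ ≃ₗ[ℂ] U × (Fin n × Fin r → ℂ) :=
    { toFun := fun x => (⟨(boolLiftEquiv _ _ x.1).1, (hmem _).1 x.2⟩, (boolLiftEquiv _ _ x.1).2)
      map_add' := fun x y => by ext <;> simp
      map_smul' := fun c x => by ext <;> simp
      invFun := fun y => ⟨(boolLiftEquiv _ _).symm (y.1.1, y.2), by
        rw [hmem, LinearEquiv.apply_symm_apply]; exact y.1.2⟩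
      left_inv := fun x => by ext; simp
      right_inv := fun y => by ext <;> simp }
  have he : e.conj (A₂.mulVecLin.restrict h₂) =
      (A.mulVecLin.restrict h).prodMap Aχ.mulVecLin := by
    refine LinearMap.ext fun y => ?_
    obtain ⟨x, rfl⟩ := e.surjective y
    rw [LinearEquiv.conj_apply_apply, LinearEquiv.symm_apply_apply]
    refine Prod.ext (Subtype.ext ?_) ?_
    · exact congrArg Prod.fst (hconj x.1)
    · exact (congrArg Prod.snd (hconj x.1) :)
  rw [← LinearEquiv.charpoly_conj e, he, LinearMap.charpoly_prodMap, ← Matrix.charpoly_toLin',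
    Matrix.toLin'_apply']
end

section
/- Let n, r, k ≥ 1, inv an involution of Fin k, and for each i ∈ Fin k let σ_i be a permutation of Fin n, χ_i : Fin n → Bool, and a_i ∈ Matrix (Fin r) (Fin r) ℂ. Let B := B(σ, 0, a) be the unsigned nonbacktracking matrix, B_χ := B(σ, χ, a) the signed one, and let B₂ be the unsigned nonbacktracking matrix of the 2-lifted permutations: B₂ is indexed by (Bool × Fin n) × Fin k × Fin r with entry at (((b',v),j,β),((b,u),i,α)) equal to (a_j)_{β,α} when j ≠ inv(i) and (b',v) = ρ_i(b,u), and 0 otherwise, where ρ_i(b,u) = (xor b (χ_i u), σ_i u). Then the characteristic polynomial of B₂ equals the product of the characteristic polynomials of B and B_χ; equivalently spec(B_{2n}(𝔗₂⊗𝔏_n, K)) = spec(B_n(𝔏_n, K)) ∪ spec(B_n(χ𝔏_n, K)) as multisets. -/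
open Matrix

/-- The signed nonbacktracking matrix `B(σ, χ, a)` of the lift given by the permutations `σ_i`,
edge-signs `χ_i`, color involution `inv`, and matrix weights `a_i`: its entry at
`((v,j,β), (u,i,α))` is `(−1 if χ_i(u) else 1) · (a_j)_{β,α}` when `j ≠ inv i` and `v = σ_i u`,
and `0` otherwise. -/
noncomputable def NB (n r k : ℕ) (inv : Fin k → Fin k) (σ : Fin k → Equiv.Perm (Fin n))
    (χ : Fin k → Fin n → Bool) (a : Fin k → Matrix (Fin r) (Fin r) ℂ) :
    Matrix (Fin n × Fin k × Fin r) (Fin n × Fin k × Fin r) ℂ :=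
  Matrix.of fun p q =>
    if p.2.1 ≠ inv q.2.1 ∧ p.1 = σ q.2.1 q.1 then
      (if χ q.2.1 q.1 then (-1 : ℂ) else 1) * a p.2.1 p.2.2 q.2.2
    else 0

/-- The (unsigned) nonbacktracking matrix of the 2-lifted permutations
`ρ_i (b,u) = (xor b (χ_i u), σ_i u)`. -/
noncomputable def NB2 (n r k : ℕ) (inv : Fin k → Fin k) (σ : Fin k → Equiv.Perm (Fin n))
    (χ : Fin k → Fin n → Bool) (a : Fin k → Matrix (Fin r) (Fin r) ℂ) :
    Matrix ((Bool × Fin n) × Fin k × Fin r) ((Bool × Fin n) × Fin k × Fin r) ℂ :=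
  Matrix.of fun p q =>
    if p.2.1 ≠ inv q.2.1 ∧ p.1 = (Bool.xor q.1.1 (χ q.2.1 q.1.2), σ q.2.1 q.1.2) then
      a p.2.1 p.2.2 q.2.2
    else 0

/-- A symmetric two-by-two block matrix has the spectrum of the sum and the difference of its
blocks. -/
theorem Matrix.charpoly_fromBlocks_symm {R m : Type*} [CommRing R] [Fintype m] [DecidableEq m]
    (X Y : Matrix m m R) :
    (fromBlocks X Y Y X).charpoly = (X + Y).charpoly * (X - Y).charpoly := by
  have conj_eq : (fromBlocks 1 1 0 1 * fromBlocks X Y Y X) * fromBlocks 1 (-1) 0 1 =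
      fromBlocks (X + Y) 0 Y (X - Y) := by
    simp only [fromBlocks_multiply]
    congr 1 <;> simp <;> abel
  have inv_eq : (fromBlocks 1 (-1) 0 1 : Matrix (m ⊕ m) (m ⊕ m) R) * fromBlocks 1 1 0 1 = 1 := by
    simp [fromBlocks_multiply, fromBlocks_one]
  rw [← charpoly_fromBlocks_zero₁₂ (M₂₁ := Y), ← conj_eq, charpoly_mul_comm, ← mul_assoc, inv_eq,
    one_mul]

/-- The part of the unsigned nonbacktracking matrix carried by the edges of sign `s`. -/
noncomputable def NBPart (n r k : ℕ) (inv : Fin k → Fin k) (σ : Fin k → Equiv.Perm (Fin n))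
    (χ : Fin k → Fin n → Bool) (a : Fin k → Matrix (Fin r) (Fin r) ℂ) (s : Bool) :
    Matrix (Fin n × Fin k × Fin r) (Fin n × Fin k × Fin r) ℂ :=
  Matrix.of fun p q =>
    if χ q.2.1 q.1 = s then NB n r k inv σ (fun _ _ => false) a p q else 0

theorem NBPart_false_add_true (n r k : ℕ) (inv : Fin k → Fin k) (σ : Fin k → Equiv.Perm (Fin n))
    (χ : Fin k → Fin n → Bool) (a : Fin k → Matrix (Fin r) (Fin r) ℂ) :
    NBPart n r k inv σ χ a false + NBPart n r k inv σ χ a true =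
      NB n r k inv σ (fun _ _ => false) a := by
  ext p q
  cases h : χ q.2.1 q.1 <;> simp [NBPart, h]

theorem NBPart_false_sub_true (n r k : ℕ) (inv : Fin k → Fin k) (σ : Fin k → Equiv.Perm (Fin n))
    (χ : Fin k → Fin n → Bool) (a : Fin k → Matrix (Fin r) (Fin r) ℂ) :
    NBPart n r k inv σ χ a false - NBPart n r k inv σ χ a true = NB n r k inv σ χ a := by
  ext p q
  cases h : χ q.2.1 q.1 <;> simp [NBPart, NB, h, neg_ite]

/-- The two sheets of a 2-lift. -/
def sheetsEquiv (α β : Type*) : (Bool × α) × β ≃ (α × β) ⊕ (α × β) :=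
  (Equiv.prodAssoc Bool α β).trans (Equiv.boolProdEquivSum (α × β))

theorem reindex_NB2 (n r k : ℕ) (inv : Fin k → Fin k) (σ : Fin k → Equiv.Perm (Fin n))
    (χ : Fin k → Fin n → Bool) (a : Fin k → Matrix (Fin r) (Fin r) ℂ) :
    reindex (sheetsEquiv _ _) (sheetsEquiv _ _) (NB2 n r k inv σ χ a) =
      fromBlocks (NBPart n r k inv σ χ a false) (NBPart n r k inv σ χ a true)
        (NBPart n r k inv σ χ a true) (NBPart n r k inv σ χ a false) := by
  ext (p | p) (q | q) <;> cases h : χ q.2.1 q.1 <;>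
    simp [sheetsEquiv, Equiv.boolProdEquivSum, NBPart, NB, NB2, h]

/-- The spectrum of the nonbacktracking matrix of a 2-lift splits:
`spec(B_{2n}(𝔗₂⊗𝔏_n, K)) = spec(B_n(𝔏_n, K)) ∪ spec(B_n(χ𝔏_n, K))` as multisets, i.e.
`charpoly B₂ = charpoly B * charpoly B_χ`. -/
theorem stmt_3 (n r k : ℕ) (hn : 1 ≤ n) (hr : 1 ≤ r) (hk : 1 ≤ k)
    (inv : Fin k → Fin k) (hinv : Function.Involutive inv)
    (σ : Fin k → Equiv.Perm (Fin n)) (χ : Fin k → Fin n → Bool)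
    (a : Fin k → Matrix (Fin r) (Fin r) ℂ) :
    (NB2 n r k inv σ χ a).charpoly =
      (NB n r k inv σ (fun _ _ => false) a).charpoly * (NB n r k inv σ χ a).charpoly := by
  rw [← charpoly_reindex (sheetsEquiv _ _) (NB2 n r k inv σ χ a), reindex_NB2,
    charpoly_fromBlocks_symm, NBPart_false_add_true, NBPart_false_sub_true]
end

section
/- In the setting of the nonbacktracking 2-lift identity (B = B(σ,0,a), B_χ = B(σ,χ,a), and B₂ the nonbacktracking matrix of the 2-lifted permutations ρ_i(b,u) = (xor b (χ_i u), σ_i u)), let W₂ be the subspace of ((Bool × Fin n) × Fin k × Fin r → ℂ) of all x with Σ_{(b,u)} x((b,u),j,β) = 0 for all j, β, and W the subspace of (Fin n × Fin k × Fin r → ℂ) of all x with Σ_u x(u,j,β) = 0 for all j, β. Then B₂ maps W₂ into W₂, B maps W into W, and the characteristic polynomial of the restriction of B₂ to W₂ equals the characteristic polynomial of the restriction of B to W multiplied by the characteristic polynomial of B_χ. (This is the identity spec(B_{2n,⊥}(𝔗₂⊗𝔏_n, K)) = spec(B_{n,⊥}(𝔏_n, K)) ∪ spec(B_n(χ𝔏_n,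 K)).) -/
open Matrix

section
variable {n r k : ℕ}

/-- The linear equivalence sending a function on a double cover to the pair formed by its
fibrewise sum and its fibrewise difference. -/
noncomputable def sumDiffEquiv (n r k : ℕ) :
    ((Bool × Fin n) × Fin k × Fin r → ℂ) ≃ₗ[ℂ]
      (Fin n × Fin k × Fin r → ℂ) × (Fin n × Fin k × Fin r → ℂ) where
  toFun x := (fun q => x ((false, q.1), q.2) + x ((true, q.1), q.2),
    fun q => x ((false, q.1), q.2) - x ((true, q.1), q.2))
  map_add' x y := by
    ext q <;> (simp; ring)
  map_smul' c x := by
    ext q <;> (simp; ring)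
  invFun y := fun p => (y.1 (p.1.2, p.2) + (if p.1.1 then -1 else 1) * y.2 (p.1.2, p.2)) / 2
  left_inv x := by
    ext ⟨⟨b, u⟩, q⟩
    cases b <;> simp <;> ring
  right_inv y := by
    ext ⟨u, q⟩ <;> (simp; ring)

theorem NB_mulVec_apply (inv : Fin k → Fin k) (σ : Fin k → Equiv.Perm (Fin n))
    (χ : Fin k → Fin n → Bool) (a : Fin k → Matrix (Fin r) (Fin r) ℂ)
    (x : Fin n × Fin k × Fin r → ℂ) (v : Fin n) (j : Fin k) (β : Fin r) :
    (NB n r k inv σ χ a).mulVecLin x (v, j, β) =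
      ∑ u : Fin n, ∑ q : Fin k × Fin r, if j ≠ inv q.1 ∧ v = σ q.1 u then
        (if χ q.1 u then (-1 : ℂ) else 1) * a j β q.2 * x (u, q) else 0 := by
  simp only [mulVecLin_apply, mulVec, dotProduct, NB, of_apply, Fintype.sum_prod_type (α₁ := Fin n),
    ite_mul, zero_mul]

theorem NB2_mulVec_apply (inv : Fin k → Fin k) (σ : Fin k → Equiv.Perm (Fin n))
    (χ : Fin k → Fin n → Bool) (a : Fin k → Matrix (Fin r) (Fin r) ℂ)
    (x : (Bool × Fin n) × Fin k × Fin r → ℂ) (b : Bool) (v : Fin n) (j : Fin k) (β : Fin r) :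
    (NB2 n r k inv σ χ a).mulVecLin x ((b, v), j, β) =
      ∑ u : Fin n, ∑ q : Fin k × Fin r, if j ≠ inv q.1 ∧ v = σ q.1 u then
        a j β q.2 * x ((b.xor (χ q.1 u), u), q) else 0 := by
  simp only [mulVecLin_apply, mulVec, dotProduct, NB2, of_apply,
    Fintype.sum_prod_type (α₁ := Bool × Fin n), Fintype.sum_prod_type (α₁ := Bool) (α₂ := Fin n),
    Fintype.sum_bool, ite_mul, zero_mul, ← Finset.sum_add_distrib]
  refine Finset.sum_congr rfl fun u _ => Finset.sum_congr rfl fun q _ => ?_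
  by_cases hj : j = inv q.1 <;> by_cases hv : v = σ q.1 u <;> cases b <;>
    cases hc : χ q.1 u <;> simp [hj, hv]

theorem sumDiffEquiv_NB2 (inv : Fin k → Fin k) (σ : Fin k → Equiv.Perm (Fin n))
    (χ : Fin k → Fin n → Bool) (a : Fin k → Matrix (Fin r) (Fin r) ℂ)
    (x : (Bool × Fin n) × Fin k × Fin r → ℂ) :
    sumDiffEquiv n r k ((NB2 n r k inv σ χ a).mulVecLin x) =
      ((NB n r k inv σ (fun _ _ => false) a).mulVecLin (sumDiffEquiv n r k x).1,
        (NB n r k inv σ χ a).mulVecLin (sumDiffEquiv n r k x).2) := by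
  refine Prod.ext ?_ ?_ <;> ext ⟨v, j, β⟩ <;>
    simp only [sumDiffEquiv, LinearEquiv.coe_mk, LinearMap.coe_mk, AddHom.coe_mk,
      NB2_mulVec_apply, NB_mulVec_apply, ← Finset.sum_add_distrib, ← Finset.sum_sub_distrib] <;>
    refine Finset.sum_congr rfl fun u _ => Finset.sum_congr rfl fun q _ => ?_ <;>
    by_cases h : j ≠ inv q.1 ∧ v = σ q.1 u
  · simp only [if_pos h]
    cases χ q.1 u <;> simp <;> ring
  · simp only [if_neg h, add_zero]
  · simp only [if_pos h]
    cases χ q.1 u <;> simp <;> ring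
  · simp only [if_neg h, sub_zero]

theorem sum_NB_mulVec_eq_zero (inv : Fin k → Fin k) (σ : Fin k → Equiv.Perm (Fin n))
    (a : Fin k → Matrix (Fin r) (Fin r) ℂ) (x : Fin n × Fin k × Fin r → ℂ)
    (hx : ∀ (j : Fin k) (β : Fin r), ∑ u : Fin n, x (u, j, β) = 0) (j : Fin k) (β : Fin r) :
    ∑ v : Fin n, (NB n r k inv σ (fun _ _ => false) a).mulVecLin x (v, j, β) = 0 := by
  simp only [NB_mulVec_apply]
  rw [Finset.sum_comm]
  have key (u : Fin n) (q : Fin k × Fin r) :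
      (∑ v : Fin n, if j ≠ inv q.1 ∧ v = σ q.1 u then
        (if false then (-1 : ℂ) else 1) * a j β q.2 * x (u, q) else 0) =
      (if j ≠ inv q.1 then a j β q.2 else 0) * x (u, q) := by
    by_cases hj : j = inv q.1 <;> simp [hj]
  calc _ = ∑ u : Fin n, ∑ q : Fin k × Fin r,
        (if j ≠ inv q.1 then a j β q.2 else 0) * x (u, q) := by
        refine Finset.sum_congr rfl fun u _ => ?_
        rw [Finset.sum_comm]
        exact Finset.sum_congr rfl fun q _ => key u q
    _ = 0 := by
        rw [Finset.sum_comm]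
        refine Finset.sum_eq_zero fun q _ => ?_
        rw [← Finset.mul_sum, hx q.1 q.2, mul_zero]

theorem sum_fst_sumDiffEquiv (x : (Bool × Fin n) × Fin k × Fin r → ℂ) (j : Fin k) (β : Fin r) :
    ∑ u : Fin n, (sumDiffEquiv n r k x).1 (u, j, β) = ∑ p : Bool × Fin n, x (p, j, β) := by
  simp [sumDiffEquiv, Fintype.sum_prod_type, Finset.sum_add_distrib, add_comm]

end

/-- Nontrivial-spectrum identity for the nonbacktracking matrix of a 2-lift:
`B₂` and `B` preserve the "sum-zero" subspaces `W₂` and `W`, and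
`charpoly (B₂|_{W₂}) = charpoly (B|_W) * charpoly B_χ`; i.e.
`spec(B_{2n,⊥}(𝔗₂⊗𝔏_n, K)) = spec(B_{n,⊥}(𝔏_n, K)) ∪ spec(B_n(χ𝔏_n, K))`. -/
theorem stmt_4 (n r k : ℕ) (hn : 1 ≤ n) (hr : 1 ≤ r) (hk : 1 ≤ k)
    (inv : Fin k → Fin k) (hinv : Function.Involutive inv)
    (σ : Fin k → Equiv.Perm (Fin n)) (χ : Fin k → Fin n → Bool)
    (a : Fin k → Matrix (Fin r) (Fin r) ℂ)
    (W₂ : Submodule ℂ ((Bool × Fin n) × Fin k × Fin r → ℂ))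
    (hW₂ : ∀ x : (Bool × Fin n) × Fin k × Fin r → ℂ,
      x ∈ W₂ ↔ ∀ (j : Fin k) (β : Fin r), ∑ p : Bool × Fin n, x (p, j, β) = 0)
    (W : Submodule ℂ (Fin n × Fin k × Fin r → ℂ))
    (hW : ∀ x : Fin n × Fin k × Fin r → ℂ,
      x ∈ W ↔ ∀ (j : Fin k) (β : Fin r), ∑ u : Fin n, x (u, j, β) = 0) :
    ∃ (h₂ : ∀ x ∈ W₂, (NB2 n r k inv σ χ a).mulVecLin x ∈ W₂)
      (h : ∀ x ∈ W, (NB n r k inv σ (fun _ _ => false) a).mulVecLin x ∈ W),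
      LinearMap.charpoly ((NB2 n r k inv σ χ a).mulVecLin.restrict h₂) =
        LinearMap.charpoly ((NB n r k inv σ (fun _ _ => false) a).mulVecLin.restrict h) *
          (NB n r k inv σ χ a).charpoly := by
  have hmem (x : (Bool × Fin n) × Fin k × Fin r → ℂ) : x ∈ W₂ ↔ (sumDiffEquiv n r k x).1 ∈ W := by
    simp only [hW₂, hW, sum_fst_sumDiffEquiv]
  have h : ∀ x ∈ W, (NB n r k inv σ (fun _ _ => false) a).mulVecLin x ∈ W := fun x hx =>
    (hW _).2 (sum_NB_mulVec_eq_zero inv σ a x ((hW x).1 hx))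
  have h₂ : ∀ x ∈ W₂, (NB2 n r k inv σ χ a).mulVecLin x ∈ W₂ := fun x hx => by
    rw [hmem, sumDiffEquiv_NB2]
    exact h _ ((hmem x).1 hx)
  refine ⟨h₂, h, ?_⟩
  let e : W₂ ≃ₗ[ℂ] W × (Fin n × Fin k × Fin r → ℂ) :=
    { toFun := fun x => (⟨(sumDiffEquiv n r k x).1, (hmem x).1 x.2⟩, (sumDiffEquiv n r k x).2)
      map_add' := fun x y => by
        refine Prod.ext (Subtype.ext ?_) ?_ <;> simp
      map_smul' := fun c x => by
        refine Prod.ext (Subtype.ext ?_) ?_ <;> simp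
      invFun := fun y => ⟨(sumDiffEquiv n r k).symm (y.1, y.2), by simp [hmem]⟩
      left_inv := fun x => by simp
      right_inv := fun y => by simp }
  have hconj : e.conj ((NB2 n r k inv σ χ a).mulVecLin.restrict h₂) =
      ((NB n r k inv σ (fun _ _ => false) a).mulVecLin.restrict h).prodMap
        (NB n r k inv σ χ a).mulVecLin := by
    refine LinearMap.ext fun y => ?_
    obtain ⟨x, rfl⟩ := e.surjective y
    rw [LinearEquiv.conj_apply_apply, LinearEquiv.symm_apply_apply]
    obtain ⟨h_fst, h_snd⟩ := Prod.ext_iff.1 (sumDiffEquiv_NB2 inv σ χ a x)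
    exact Prod.ext (Subtype.ext h_fst) h_snd
  rw [← LinearEquiv.charpoly_conj e, hconj, LinearMap.charpoly_prodMap, Matrix.charpoly_mulVecLin]
end

section
/- (Ihara–Bass correspondence for matrix-weighted lifts.) Let n, r, k ≥ 1, inv an involution of Fin k, a_i ∈ Matrix (Fin r) (Fin r) ℂ with a_{inv(i)} = (a_i)ᴴ for all i, and σ_i permutations of Fin n with σ_{inv(i)} = σ_i⁻¹. Let B := B(σ, 0, a) be the nonbacktracking matrix. Let λ ∈ ℂ be such that λ²·1 − a_{inv(i)}·a_i is invertible for every i ∈ Fin k. Define ã₀ := −1 − Σ_{i ∈ Fin k} a_i · (λ²·1 − a_{inv(i)} a_i)⁻¹ · a_{inv(i)} and ã_i := λ · a_i · (λ²·1 − a_{inv(i)} a_i)⁻¹, and let A_λ := I_n ⊗ ã₀ + Σ_{i ∈ Fin k} P_{σ_i} ⊗ ã_i (a matrix indexed by Fin n × Fin r). Then λ ∈ spectrum ℂ B if and only if 0 ∈ spectrum ℂ A_λ; equivalently, det(λ·1 − B) = 0 if and only if det(A_λ) = 0. -/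
open Matrix
open scoped Kronecker

/-- `ã₀ = −1 − ∑ᵢ aᵢ (λ²·1 − a_{inv i} aᵢ)⁻¹ a_{inv i}`. -/
noncomputable def atilde0 (r k : ℕ) (inv : Fin k → Fin k)
    (a : Fin k → Matrix (Fin r) (Fin r) ℂ) (lam : ℂ) : Matrix (Fin r) (Fin r) ℂ :=
  -1 - ∑ i : Fin k,
    a i * (lam ^ 2 • (1 : Matrix (Fin r) (Fin r) ℂ) - a (inv i) * a i)⁻¹ * a (inv i)

/-- `ãᵢ = λ · aᵢ (λ²·1 − a_{inv i} aᵢ)⁻¹`. -/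
noncomputable def atilde (r k : ℕ) (inv : Fin k → Fin k)
    (a : Fin k → Matrix (Fin r) (Fin r) ℂ) (lam : ℂ) (i : Fin k) :
    Matrix (Fin r) (Fin r) ℂ :=
  lam • (a i * (lam ^ 2 • (1 : Matrix (Fin r) (Fin r) ℂ) - a (inv i) * a i)⁻¹)

/-- `A_λ = Iₙ ⊗ ã₀ + ∑ᵢ P_{σᵢ} ⊗ ãᵢ`. -/
noncomputable def Alam (n r k : ℕ) (inv : Fin k → Fin k) (σ : Fin k → Equiv.Perm (Fin n))
    (a : Fin k → Matrix (Fin r) (Fin r) ℂ) (lam : ℂ) :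
    Matrix (Fin n × Fin r) (Fin n × Fin r) ℂ :=
  (1 : Matrix (Fin n) (Fin n) ℂ) ⊗ₖ atilde0 r k inv a lam +
    ∑ i : Fin k,
      (Matrix.of fun v u : Fin n => if v = σ i u then (1 : ℂ) else 0) ⊗ₖ
        atilde r k inv a lam i

/-- Row `(v, j)` of `B x` is `a_j` applied to the sum of the incoming entries of `x`, without the
backtracking one. -/
theorem NB_mulVec {n r k : ℕ} {inv : Fin k → Fin k} (hinv : Function.Involutive inv)
    {σ : Fin k → Equiv.Perm (Fin n)} (hσ : ∀ i, σ (inv i) = (σ i)⁻¹)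
    (a : Fin k → Matrix (Fin r) (Fin r) ℂ) (x : Fin n × Fin k × Fin r → ℂ)
    (v : Fin n) (j : Fin k) :
    (fun β => (NB n r k inv σ (fun _ _ => false) a *ᵥ x) (v, j, β)) =
      a j *ᵥ ((∑ i, fun α => x ((σ i)⁻¹ v, i, α)) - fun α => x (σ j v, inv j, α)) := by
  have sum_ne : ((∑ i, fun α => x ((σ i)⁻¹ v, i, α)) - fun α => x (σ j v, inv j, α)) =
      ∑ i, fun α => if j ≠ inv i then x ((σ i)⁻¹ v, i, α) else 0 := by
    rw [sub_eq_iff_eq_add, ← Finset.add_sum_erase _ _ (Finset.mem_univ (inv j)),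
      ← Finset.add_sum_erase _ (fun i => fun α => if j ≠ inv i then _ else _)
        (Finset.mem_univ (inv j)), add_comm]
    have hs : ∀ i ∈ Finset.univ.erase (inv j),
        (fun α => x ((σ i)⁻¹ v, i, α)) =
          fun α => if j ≠ inv i then x ((σ i)⁻¹ v, i, α) else 0 := by
      intro i hi
      have : j ≠ inv i := fun h => Finset.ne_of_mem_erase hi (by rw [h, hinv])
      simp [this]
    rw [Finset.sum_congr rfl hs]
    ext α
    simp [hinv j, hσ]
  rw [sum_ne, Matrix.mulVec_sum]
  ext β
  have inner (i : Fin k) (u : Fin n) : (∑ α, (NB n r k inv σ (fun _ _ => false) a)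
      (v, j, β) (u, i, α) * x (u, i, α)) = if u = (σ i)⁻¹ v then
        (a j *ᵥ fun α => if j ≠ inv i then x ((σ i)⁻¹ v, i, α) else 0) β else 0 := by
    have hu : v = σ i u ↔ u = (σ i)⁻¹ v := by
      rw [Equiv.Perm.eq_inv_iff_eq, eq_comm]
    by_cases h : u = (σ i)⁻¹ v
    · have hv := hu.2 h
      by_cases hj : j = inv i
      · simp [NB, hj, mulVec, dotProduct]
      · subst hv
        simp [NB, hj, mulVec, dotProduct]
    · rw [if_neg h]
      refine Finset.sum_eq_zero fun α _ => ?_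
      rw [NB, of_apply, if_neg fun h' => h (hu.1 h'.2), zero_mul]
  simp only [mulVec, dotProduct, Fintype.sum_prod_type, Finset.sum_apply]
  rw [Finset.sum_comm]
  refine Finset.sum_congr rfl fun i _ => ?_
  rw [Finset.sum_congr rfl fun u _ => inner i u]
  simp [mulVec, dotProduct]

theorem perm_kronecker_mulVec {n r : ℕ} (τ : Equiv.Perm (Fin n)) (m : Matrix (Fin r) (Fin r) ℂ)
    (y : Fin n × Fin r → ℂ) (v : Fin n) :
    (fun β => (((Matrix.of fun v u : Fin n => if v = τ u then (1 : ℂ) else 0) ⊗ₖ m) *ᵥ y) (v, β)) =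
      m *ᵥ fun α => y (τ⁻¹ v, α) := by
  ext β
  have hu (u : Fin n) : v = τ u ↔ u = τ⁻¹ v := by
    rw [Equiv.Perm.eq_inv_iff_eq, eq_comm]
  simp only [mulVec, dotProduct, Fintype.sum_prod_type, kroneckerMap_apply, of_apply, hu]
  rw [Finset.sum_eq_single (τ⁻¹ v)] <;> simp +contextual

theorem Alam_mulVec {n r k : ℕ} (inv : Fin k → Fin k) (σ : Fin k → Equiv.Perm (Fin n))
    (a : Fin k → Matrix (Fin r) (Fin r) ℂ) (lam : ℂ) (y : Fin n × Fin r → ℂ) (v : Fin n) :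
    (fun β => (Alam n r k inv σ a lam *ᵥ y) (v, β)) =
      atilde0 r k inv a lam *ᵥ (fun α => y (v, α)) +
        ∑ i, atilde r k inv a lam i *ᵥ fun α => y ((σ i)⁻¹ v, α) := by
  have h1 := perm_kronecker_mulVec 1 (atilde0 r k inv a lam) y v
  have one_eq : (Matrix.of fun v u : Fin n => if v = (1 : Equiv.Perm (Fin n)) u then (1 : ℂ) else 0)
      = 1 := by
    ext v u
    rw [of_apply, Equiv.Perm.one_apply, Matrix.one_apply]
  rw [one_eq] at h1
  simp only [← perm_kronecker_mulVec]
  rw [inv_one, Equiv.Perm.one_apply] at h1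
  rw [← h1]
  ext β
  simp [Alam, add_mulVec, sum_mulVec]

/-- The matrix `A_λ` applied to `y` measures the failure of `y` to be the sum of the edge vector
`aᵢ (λ² - a_{inv i} aᵢ)⁻¹ (λ y(u) - a_{inv i} y(σᵢ u))` it determines. -/
theorem Alam_mulVec_eq_sum_sub {n r k : ℕ} (inv : Fin k → Fin k) (σ : Fin k → Equiv.Perm (Fin n))
    (a : Fin k → Matrix (Fin r) (Fin r) ℂ) (lam : ℂ) (y : Fin n × Fin r → ℂ) (v : Fin n) :
    (fun β => (Alam n r k inv σ a lam *ᵥ y) (v, β)) =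
      (∑ i, (a i * (lam ^ 2 • (1 : Matrix (Fin r) (Fin r) ℂ) - a (inv i) * a i)⁻¹) *ᵥ
        (lam • (fun α => y ((σ i)⁻¹ v, α)) - a (inv i) *ᵥ fun α => y (v, α))) -
      fun α => y (v, α) := by
  rw [Alam_mulVec]
  simp only [atilde0, atilde, sub_mulVec, neg_mulVec, one_mulVec, sum_mulVec, mulVec_sub,
    mulVec_smul, smul_mulVec, mulVec_mulVec, Finset.sum_sub_distrib]
  abel

/-- A matrix `a` intertwines the resolvents of `b a` and `a b`. -/
theorem resolvent_intertwine {r : ℕ} {a b : Matrix (Fin r) (Fin r) ℂ} {c : ℂ}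
    (h : IsUnit (c • (1 : Matrix (Fin r) (Fin r) ℂ) - b * a))
    (h' : IsUnit (c • (1 : Matrix (Fin r) (Fin r) ℂ) - a * b)) :
    a * (c • (1 : Matrix (Fin r) (Fin r) ℂ) - b * a)⁻¹ =
      (c • (1 : Matrix (Fin r) (Fin r) ℂ) - a * b)⁻¹ * a := by
  rw [Matrix.isUnit_iff_isUnit_det] at h h'
  have e : (c • (1 : Matrix (Fin r) (Fin r) ℂ) - a * b) * a =
      a * (c • (1 : Matrix (Fin r) (Fin r) ℂ) - b * a) := by
    simp [sub_mul, mul_sub, mul_assoc]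
  calc _ = (c • (1 : Matrix (Fin r) (Fin r) ℂ) - a * b)⁻¹ *
        ((c • (1 : Matrix (Fin r) (Fin r) ℂ) - a * b) * a) *
        (c • (1 : Matrix (Fin r) (Fin r) ℂ) - b * a)⁻¹ := by
        rw [nonsing_inv_mul_cancel_left _ _ h']
    _ = _ := by rw [e, ← mul_assoc, mul_nonsing_inv_cancel_right _ _ h]

/-- An edge vector satisfying the eigenvalue equation on an edge and on its reverse is determined
by its vertex sums. -/
theorem edge_eq_of_eigen {r : ℕ} {a b : Matrix (Fin r) (Fin r) ℂ} {c : ℂ}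
    (h : IsUnit (c ^ 2 • (1 : Matrix (Fin r) (Fin r) ℂ) - b * a))
    (h' : IsUnit (c ^ 2 • (1 : Matrix (Fin r) (Fin r) ℂ) - a * b))
    {x x' y y' : Fin r → ℂ} (hx : c • x = a *ᵥ (y - x')) (hx' : c • x' = b *ᵥ (y' - x)) :
    x = (a * (c ^ 2 • (1 : Matrix (Fin r) (Fin r) ℂ) - b * a)⁻¹) *ᵥ (c • y - b *ᵥ y') := by
  rw [resolvent_intertwine h h', ← mulVec_mulVec]
  rw [Matrix.isUnit_iff_isUnit_det] at h'
  have e : (c ^ 2 • (1 : Matrix (Fin r) (Fin r) ℂ) - a * b) *ᵥ x = a *ᵥ (c • y - b *ᵥ y') := by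
    have : c ^ 2 • x = a *ᵥ (c • y - b *ᵥ (y' - x)) := by
      rw [← hx', pow_two, mul_smul, hx, ← mulVec_smul, smul_sub]
    rw [sub_mulVec, smul_mulVec, one_mulVec, this]
    simp only [mulVec_sub, mulVec_mulVec]
    abel
  rw [← e, mulVec_mulVec, nonsing_inv_mul _ h', one_mulVec]

/-- The edge vectors built from the vertex values solve the eigenvalue equation. -/
theorem edge_eigen {r : ℕ} {a b : Matrix (Fin r) (Fin r) ℂ} {c : ℂ}
    (h : IsUnit (c ^ 2 • (1 : Matrix (Fin r) (Fin r) ℂ) - b * a))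
    (h' : IsUnit (c ^ 2 • (1 : Matrix (Fin r) (Fin r) ℂ) - a * b)) (y y' : Fin r → ℂ) :
    c • (a * (c ^ 2 • (1 : Matrix (Fin r) (Fin r) ℂ) - b * a)⁻¹) *ᵥ (c • y - b *ᵥ y') =
      a *ᵥ (y - (b * (c ^ 2 • (1 : Matrix (Fin r) (Fin r) ℂ) - a * b)⁻¹) *ᵥ
        (c • y' - a *ᵥ y)) := by
  rw [resolvent_intertwine h' h, ← mulVec_mulVec, ← mulVec_mulVec]
  rw [Matrix.isUnit_iff_isUnit_det] at h
  have e : y = (c ^ 2 • (1 : Matrix (Fin r) (Fin r) ℂ) - b * a)⁻¹ *ᵥ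
      ((c ^ 2 • (1 : Matrix (Fin r) (Fin r) ℂ) - b * a) *ᵥ y) := by
    rw [mulVec_mulVec, nonsing_inv_mul _ h, one_mulVec]
  conv_rhs => enter [2, 1]; rw [e]
  rw [← mulVec_smul, ← mulVec_smul, ← mulVec_sub]
  congr 2
  simp only [sub_mulVec, smul_mulVec, one_mulVec, mulVec_sub, mulVec_mulVec, mulVec_smul, smul_sub,
    pow_two, mul_smul]
  abel

theorem mem_spectrum_iff_det_eq_zero {ι : Type*} [Fintype ι] [DecidableEq ι] (c : ℂ)
    (m : Matrix ι ι ℂ) : c ∈ spectrum ℂ m ↔ (c • (1 : Matrix ι ι ℂ) - m).det = 0 := by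
  rw [spectrum.mem_iff, Algebra.algebraMap_eq_smul_one, Matrix.isUnit_iff_isUnit_det,
    isUnit_iff_ne_zero, not_not]

/-- The Ihara–Bass correspondence at the level of kernels; no relation between `a (inv i)` and the
adjoint of `a i` is needed. -/
theorem det_NB_eq_zero_iff {n r k : ℕ} {inv : Fin k → Fin k} (hinv : Function.Involutive inv)
    (a : Fin k → Matrix (Fin r) (Fin r) ℂ)
    {σ : Fin k → Equiv.Perm (Fin n)} (hσ : ∀ i, σ (inv i) = (σ i)⁻¹) {lam : ℂ}
    (hlam : ∀ i, IsUnit (lam ^ 2 • (1 : Matrix (Fin r) (Fin r) ℂ) - a (inv i) * a i)) :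
    (lam • (1 : Matrix (Fin n × Fin k × Fin r) (Fin n × Fin k × Fin r) ℂ) -
        NB n r k inv σ (fun _ _ => false) a).det = 0 ↔ (Alam n r k inv σ a lam).det = 0 := by
  have hlam' (i : Fin k) :
      IsUnit (lam ^ 2 • (1 : Matrix (Fin r) (Fin r) ℂ) - a i * a (inv i)) := by
    simpa only [hinv i] using hlam (inv i)
  have apply_inv_apply (i : Fin k) (v : Fin n) : σ i ((σ i)⁻¹ v) = v :=
    (σ i).apply_symm_apply v
  have eigen_iff (x : Fin n × Fin k × Fin r → ℂ) :
      (lam • (1 : Matrix (Fin n × Fin k × Fin r) (Fin n × Fin k × Fin r) ℂ) -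
        NB n r k inv σ (fun _ _ => false) a) *ᵥ x = 0 ↔
      ∀ v j, lam • (fun β => x (v, j, β)) =
        a j *ᵥ ((∑ i, fun α => x ((σ i)⁻¹ v, i, α)) - fun α => x (σ j v, inv j, α)) := by
    simp only [← NB_mulVec hinv hσ]
    rw [sub_mulVec, smul_mulVec, one_mulVec, sub_eq_zero]
    simp [funext_iff]
  rw [← Matrix.exists_mulVec_eq_zero_iff, ← Matrix.exists_mulVec_eq_zero_iff]
  constructor
  · rintro ⟨x, hx0, hx⟩
    rw [eigen_iff] at hx
    set y : Fin n × Fin r → ℂ := fun p => (∑ i, fun α => x ((σ i)⁻¹ p.1, i, α)) p.2 with hy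
    have key (v : Fin n) (j : Fin k) : (fun β => x (v, j, β)) =
        (a j * (lam ^ 2 • (1 : Matrix (Fin r) (Fin r) ℂ) - a (inv j) * a j)⁻¹) *ᵥ
          (lam • (fun α => y (v, α)) - a (inv j) *ᵥ fun α => y (σ j v, α)) := by
      refine edge_eq_of_eigen (hlam j) (hlam' j) (hx v j) ?_
      have := hx (σ j v) (inv j)
      rw [hinv j, hσ, show (σ j)⁻¹ (σ j v) = v from (σ j).symm_apply_apply v] at this
      exact this
    refine ⟨y, fun hy0 => hx0 ?_, ?_⟩
    · ext ⟨v, j, β⟩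
      have := congrFun (key v j) β
      rw [hy0] at this
      simpa [← Pi.zero_def] using this
    · ext ⟨v, β⟩
      have := congrFun (Alam_mulVec_eq_sum_sub inv σ a lam y v) β
      refine this.trans ?_
      have hk (i : Fin k) := key ((σ i)⁻¹ v) i
      simp only [apply_inv_apply] at hk
      simp only [← hk]
      simp [hy]
  · rintro ⟨y, hy0, hy⟩
    set x : Fin n × Fin k × Fin r → ℂ := fun p =>
      ((a p.2.1 * (lam ^ 2 • (1 : Matrix (Fin r) (Fin r) ℂ) - a (inv p.2.1) * a p.2.1)⁻¹) *ᵥ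
          (lam • (fun α => y (p.1, α)) - a (inv p.2.1) *ᵥ fun α => y (σ p.2.1 p.1, α))) p.2.2
      with hx
    have hsum (v : Fin n) : (∑ i, fun α => x ((σ i)⁻¹ v, i, α)) = fun α => y (v, α) := by
      have := Alam_mulVec_eq_sum_sub inv σ a lam y v
      rw [hy] at this
      rw [← sub_eq_zero]
      simp only [hx, apply_inv_apply]
      exact this.symm
    refine ⟨x, fun hx0 => hy0 ?_, (eigen_iff x).2 fun v j => ?_⟩
    · ext ⟨v, β⟩
      have := congrFun (hsum v) β
      rw [hx0] at this
      simpa using this.symm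
    · rw [hsum]
      have := edge_eigen (hlam j) (hlam' j) (fun α => y (v, α)) (fun α => y (σ j v, α))
      simpa [hx, hinv j, hσ] using this

/-- Ihara–Bass correspondence for matrix-weighted lifts: under the stated
symmetry hypotheses, and for `λ` with `λ²·1 − a_{inv i} aᵢ` invertible for all `i`,
`λ ∈ spec(B)` iff `0 ∈ spec(A_λ)`; equivalently `det(λ·1 − B) = 0` iff `det A_λ = 0`. -/
theorem stmt_5 (n r k : ℕ) (hn : 1 ≤ n) (hr : 1 ≤ r) (hk : 1 ≤ k)
    (inv : Fin k → Fin k) (hinv : Function.Involutive inv)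
    (a : Fin k → Matrix (Fin r) (Fin r) ℂ) (ha : ∀ i, a (inv i) = (a i)ᴴ)
    (σ : Fin k → Equiv.Perm (Fin n)) (hσ : ∀ i, σ (inv i) = (σ i)⁻¹)
    (lam : ℂ)
    (hlam : ∀ i, IsUnit (lam ^ 2 • (1 : Matrix (Fin r) (Fin r) ℂ) - a (inv i) * a i)) :
    (lam ∈ spectrum ℂ (NB n r k inv σ (fun _ _ => false) a) ↔
        0 ∈ spectrum ℂ (Alam n r k inv σ a lam)) ∧
    ((lam • (1 : Matrix (Fin n × Fin k × Fin r) (Fin n × Fin k × Fin r) ℂ) -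
          NB n r k inv σ (fun _ _ => false) a).det = 0 ↔
        (Alam n r k inv σ a lam).det = 0) := by
  have h := det_NB_eq_zero_iff hinv a hσ hlam
  refine ⟨?_, h⟩
  rw [mem_spectrum_iff_det_eq_zero, mem_spectrum_iff_det_eq_zero, h, zero_smul, zero_sub, det_neg]
  simp
end

section
/- (Ihara–Bass correspondence on the nontrivial subspace.) In the setting of the Ihara–Bass correspondence (inv an involution of Fin k, a_{inv(i)} = (a_i)ᴴ, σ_{inv(i)} = σ_i⁻¹, λ ∈ ℂ with λ²·1 − a_{inv(i)} a_i invertible for all i, B the nonbacktracking matrix, ã₀, ã_i, and A_λ = I_n ⊗ ã₀ + Σ_i P_{σ_i} ⊗ ã_i as defined there), let W_B be the subspace of (Fin n × Fin k × Fin r → ℂ) of all x with Σ_u x(u,j,β) = 0 for all j, β, and W_A the subspace of (Fin n × Fin r → ℂ) of all y with Σ_u y(u,β) = 0 for all β. Then B maps W_B into W_B, A_λ maps W_A into W_A, and λ is an eigenvalue of the restriction of B to W_B if and only if 0 is an eigenvalue of the restriction of A_λ to W_A. -/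
open Matrix
open scoped Kronecker

/-- `μ` is an eigenvalue of the restriction of `f` to an invariant subspace iff that subspace
contains an eigenvector. -/
theorem hasEigenvalue_restrict_iff {K V : Type*} [Field K] [AddCommGroup V] [Module K V]
    (f : V →ₗ[K] V) (W : Submodule K V) (h : ∀ x ∈ W, f x ∈ W) (μ : K) :
    Module.End.HasEigenvalue (f.restrict h) μ ↔ ∃ x ∈ W, x ≠ 0 ∧ f x = μ • x := by
  constructor
  · intro hμ
    obtain ⟨x, hx⟩ := hμ.exists_hasEigenvector
    refine ⟨x, x.2, fun h0 => hx.2 (Subtype.ext h0), ?_⟩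
    simpa using congrArg Subtype.val hx.apply_eq_smul
  · rintro ⟨x, hxW, hx0, hx⟩
    refine Module.End.hasEigenvalue_of_hasEigenvector (x := ⟨x, hxW⟩) ⟨?_, ?_⟩
    · rw [Module.End.mem_eigenspace_iff]
      exact Subtype.ext hx
    · exact fun h0 => hx0 (congrArg Subtype.val h0)

/-- The nonbacktracking matrix acts on fibres by
`(B x)(v, j) = a_j (∑ᵢ x(σᵢ⁻¹ v, i) - x(σ_j v, inv j))`. -/
theorem NB_mulVec_apply_s6 {n r k : ℕ} {inv : Fin k → Fin k} (hinv : Function.Involutive inv)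
    (a : Fin k → Matrix (Fin r) (Fin r) ℂ) (σ : Fin k → Equiv.Perm (Fin n))
    (hσ : ∀ i, σ (inv i) = (σ i)⁻¹) (x : Fin n × Fin k × Fin r → ℂ) (v : Fin n) (j : Fin k) :
    (fun β => (NB n r k inv σ (fun _ _ => false) a *ᵥ x) (v, j, β)) =
      a j *ᵥ (∑ i, (fun β => x ((σ i)⁻¹ v, i, β)) - fun β => x (σ j v, inv j, β)) := by
  have key : (∑ i, (fun β => x ((σ i)⁻¹ v, i, β)) - fun β => x (σ j v, inv j, β)) =
      ∑ i, if j ≠ inv i then (fun β => x ((σ i)⁻¹ v, i, β)) else 0 := by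
    rw [← Finset.add_sum_erase _ _ (Finset.mem_univ (inv j)),
      ← Finset.add_sum_erase _ (fun i => ite (j ≠ inv i) _ _) (Finset.mem_univ (inv j))]
    simp only [hσ, inv_inv, hinv j, ne_eq, not_true_eq_false, if_false, zero_add,
      add_sub_cancel_left]
    refine Finset.sum_congr rfl fun i hi => ?_
    rw [if_pos]
    rintro rfl
    exact (Finset.ne_of_mem_erase hi) (hinv i).symm
  rw [key]
  funext β
  simp only [Matrix.mulVec, dotProduct, NB, Matrix.of_apply, Fintype.sum_prod_type,
    Finset.sum_apply, Finset.mul_sum]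
  rw [Finset.sum_comm, Finset.sum_comm (s := (Finset.univ : Finset (Fin r)))]
  refine Finset.sum_congr rfl fun i _ => ?_
  rw [Finset.sum_comm]
  refine Finset.sum_congr rfl fun γ _ => ?_
  rw [Finset.sum_eq_single ((σ i)⁻¹ v)]
  · by_cases hj : j = inv i <;> simp [hj]
  · intro u _ hu
    rw [if_neg, zero_mul]
    rintro ⟨-, h⟩
    exact hu (by simp [h])
  · simp

/-- `A_λ` acts on fibres by `(A_λ y)(v) = ã₀ y(v) + ∑ᵢ ãᵢ y(σᵢ⁻¹ v)`. -/
theorem Alam_mulVec_apply {n r k : ℕ} (inv : Fin k → Fin k)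
    (a : Fin k → Matrix (Fin r) (Fin r) ℂ) (σ : Fin k → Equiv.Perm (Fin n)) (lam : ℂ)
    (y : Fin n × Fin r → ℂ) (v : Fin n) :
    (fun β => (Alam n r k inv σ a lam *ᵥ y) (v, β)) =
      atilde0 r k inv a lam *ᵥ (fun β => y (v, β)) +
        ∑ i, atilde r k inv a lam i *ᵥ (fun β => y ((σ i)⁻¹ v, β)) := by
  funext β
  simp only [Alam, Matrix.add_mulVec, Matrix.sum_mulVec, Pi.add_apply, Finset.sum_apply]
  congr 1
  · simp [Matrix.mulVec, dotProduct, Fintype.sum_prod_type, Matrix.one_apply, ite_mul,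
      Finset.sum_ite_irrel]
  · refine Finset.sum_congr rfl fun i _ => ?_
    simp only [Matrix.mulVec, dotProduct, Fintype.sum_prod_type, Matrix.kroneckerMap_apply,
      Matrix.of_apply]
    rw [Finset.sum_eq_single ((σ i)⁻¹ v)]
    · simp
    · intro u _ hu
      have hv : v ≠ σ i u := by
        rintro rfl
        exact hu (by simp)
      simp [hv]
    · simp

/-- Commutation of `b` with resolvents: `b (z - c b)⁻¹ = (z - b c)⁻¹ b`. -/
theorem mul_inv_smul_one_sub_mul {m : Type*} [Fintype m] [DecidableEq m] {z : ℂ}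
    {b c : Matrix m m ℂ} (h₁ : IsUnit (z • (1 : Matrix m m ℂ) - c * b))
    (h₂ : IsUnit (z • (1 : Matrix m m ℂ) - b * c)) :
    b * (z • (1 : Matrix m m ℂ) - c * b)⁻¹ = (z • (1 : Matrix m m ℂ) - b * c)⁻¹ * b := by
  have d₁ := (Matrix.isUnit_iff_isUnit_det _).1 h₁
  have d₂ := (Matrix.isUnit_iff_isUnit_det _).1 h₂
  have comm : (z • (1 : Matrix m m ℂ) - b * c) * b = b * (z • (1 : Matrix m m ℂ) - c * b) := by
    simp [sub_mul, mul_sub, mul_assoc]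
  calc _ = (z • (1 : Matrix m m ℂ) - b * c)⁻¹ * ((z • (1 : Matrix m m ℂ) - b * c) * b) *
        (z • (1 : Matrix m m ℂ) - c * b)⁻¹ := by
        rw [Matrix.nonsing_inv_mul_cancel_left _ _ d₂]
    _ = _ := by rw [comm, ← mul_assoc, Matrix.mul_nonsing_inv_cancel_right _ _ d₁]

/-- The pair of edge equations determines the edge value from the two vertex values. -/
theorem eq_mulVec_of_edge_equations {m : Type*} [Fintype m] [DecidableEq m] {z : ℂ}
    {b c : Matrix m m ℂ} (h₁ : IsUnit (z ^ 2 • (1 : Matrix m m ℂ) - c * b))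
    (h₂ : IsUnit (z ^ 2 • (1 : Matrix m m ℂ) - b * c)) {x x' y y' : m → ℂ}
    (h : b *ᵥ (y - x') = z • x) (h' : c *ᵥ (y' - x) = z • x') :
    x = (b * (z ^ 2 • (1 : Matrix m m ℂ) - c * b)⁻¹) *ᵥ (z • y - c *ᵥ y') := by
  have d₂ := (Matrix.isUnit_iff_isUnit_det _).1 h₂
  have e : (z ^ 2 • (1 : Matrix m m ℂ) - b * c) *ᵥ x = b *ᵥ (z • y - c *ᵥ y') := by
    have e₁ : z • (b *ᵥ (y - x')) = z ^ 2 • x := by rw [h, smul_smul, sq]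
    have e₂ : b *ᵥ (c *ᵥ (y' - x)) = z • (b *ᵥ x') := by rw [h', Matrix.mulVec_smul]
    rw [Matrix.mulVec_sub, smul_sub, ← e₂] at e₁
    rw [Matrix.sub_mulVec, Matrix.smul_mulVec, Matrix.one_mulVec, ← e₁]
    simp only [Matrix.mulVec_sub, Matrix.mulVec_smul, ← Matrix.mulVec_mulVec]
    abel
  rw [mul_inv_smul_one_sub_mul h₁ h₂, ← Matrix.mulVec_mulVec, ← e, Matrix.mulVec_mulVec,
    Matrix.nonsing_inv_mul _ d₂, Matrix.one_mulVec]

/-- Edge values built from vertex values satisfy the edge equation. -/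
theorem edge_equation {m : Type*} [Fintype m] [DecidableEq m] {z : ℂ}
    {b c : Matrix m m ℂ} (h₁ : IsUnit (z ^ 2 • (1 : Matrix m m ℂ) - c * b))
    (h₂ : IsUnit (z ^ 2 • (1 : Matrix m m ℂ) - b * c)) (y y' : m → ℂ) :
    b *ᵥ (y - (c * (z ^ 2 • (1 : Matrix m m ℂ) - b * c)⁻¹) *ᵥ (z • y' - b *ᵥ y)) =
      z • ((b * (z ^ 2 • (1 : Matrix m m ℂ) - c * b)⁻¹) *ᵥ (z • y - c *ᵥ y')) := by
  have d₁ := (Matrix.isUnit_iff_isUnit_det _).1 h₁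
  rw [mul_inv_smul_one_sub_mul h₂ h₁]
  have e : y = (z ^ 2 • (1 : Matrix m m ℂ) - c * b)⁻¹ *ᵥ
      (z ^ 2 • y - c *ᵥ (b *ᵥ y)) := by
    have : z ^ 2 • y - c *ᵥ (b *ᵥ y) = (z ^ 2 • (1 : Matrix m m ℂ) - c * b) *ᵥ y := by
      rw [Matrix.sub_mulVec, Matrix.smul_mulVec, Matrix.one_mulVec, Matrix.mulVec_mulVec]
    rw [this, Matrix.mulVec_mulVec, Matrix.nonsing_inv_mul _ d₁, Matrix.one_mulVec]
  conv_lhs => enter [2, 1]; rw [e]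
  rw [← Matrix.mulVec_mulVec, ← Matrix.mulVec_sub, ← Matrix.mulVec_mulVec, ← Matrix.mulVec_smul,
    ← Matrix.mulVec_smul]
  congr 2
  simp only [Matrix.mulVec_sub, Matrix.mulVec_smul, smul_sub, smul_smul, sq]
  abel

/-- `A_λ y` is the defect in recovering `y` from the edge values built from it. -/
theorem Alam_mulVec_apply_eq_sub {n r k : ℕ} (inv : Fin k → Fin k)
    (a : Fin k → Matrix (Fin r) (Fin r) ℂ) (σ : Fin k → Equiv.Perm (Fin n)) (lam : ℂ)
    (y : Fin n × Fin r → ℂ) (v : Fin n) :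
    (fun β => (Alam n r k inv σ a lam *ᵥ y) (v, β)) =
      ∑ i, (a i * (lam ^ 2 • (1 : Matrix (Fin r) (Fin r) ℂ) - a (inv i) * a i)⁻¹) *ᵥ
        (lam • (fun β => y ((σ i)⁻¹ v, β)) - a (inv i) *ᵥ fun β => y (v, β)) -
      fun β => y (v, β) := by
  rw [Alam_mulVec_apply]
  simp only [atilde0, atilde, Matrix.sub_mulVec, Matrix.neg_mulVec, Matrix.one_mulVec,
    Matrix.sum_mulVec, Matrix.mulVec_sub, Matrix.mulVec_smul, Matrix.smul_mulVec,
    Matrix.mulVec_mulVec, Finset.sum_sub_distrib]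
  abel

/-- Ihara–Bass correspondence on the nontrivial subspace: `B` preserves `W_B`,
`A_λ` preserves `W_A`, and `λ` is an eigenvalue of `B|_{W_B}` iff `0` is an eigenvalue of
`A_λ|_{W_A}`. -/
theorem stmt_6 (n r k : ℕ) (hn : 1 ≤ n) (hr : 1 ≤ r) (hk : 1 ≤ k)
    (inv : Fin k → Fin k) (hinv : Function.Involutive inv)
    (a : Fin k → Matrix (Fin r) (Fin r) ℂ) (ha : ∀ i, a (inv i) = (a i)ᴴ)
    (σ : Fin k → Equiv.Perm (Fin n)) (hσ : ∀ i, σ (inv i) = (σ i)⁻¹)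
    (lam : ℂ)
    (hlam : ∀ i, IsUnit (lam ^ 2 • (1 : Matrix (Fin r) (Fin r) ℂ) - a (inv i) * a i))
    (WB : Submodule ℂ (Fin n × Fin k × Fin r → ℂ))
    (hWB : ∀ x : Fin n × Fin k × Fin r → ℂ,
      x ∈ WB ↔ ∀ (j : Fin k) (β : Fin r), ∑ u : Fin n, x (u, j, β) = 0)
    (WA : Submodule ℂ (Fin n × Fin r → ℂ))
    (hWA : ∀ y : Fin n × Fin r → ℂ, y ∈ WA ↔ ∀ β : Fin r, ∑ u : Fin n, y (u, β) = 0) :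
    ∃ (hB : ∀ x ∈ WB, (NB n r k inv σ (fun _ _ => false) a).mulVecLin x ∈ WB)
      (hA : ∀ y ∈ WA, (Alam n r k inv σ a lam).mulVecLin y ∈ WA),
      (Module.End.HasEigenvalue
          ((NB n r k inv σ (fun _ _ => false) a).mulVecLin.restrict hB) lam ↔
        Module.End.HasEigenvalue ((Alam n r k inv σ a lam).mulVecLin.restrict hA) 0) := by
  have hl : ∀ i, IsUnit (lam ^ 2 • (1 : Matrix (Fin r) (Fin r) ℂ) - a i * a (inv i)) := by
    intro i
    simpa [hinv i] using hlam (inv i)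
  have hWB' : ∀ x, x ∈ WB ↔ ∀ j, ∑ u, (fun β => x (u, j, β)) = 0 := by
    intro x
    simp only [hWB, funext_iff, Finset.sum_apply, Pi.zero_apply]
  have hWA' : ∀ y, y ∈ WA ↔ ∑ u, (fun β => y (u, β)) = 0 := by
    intro y
    simp only [hWA, funext_iff, Finset.sum_apply, Pi.zero_apply]
  have sum_WB : ∀ x ∈ WB, ∀ (τ : Equiv.Perm (Fin n)) (j : Fin k),
      ∑ u, (fun β => x (τ u, j, β)) = 0 := fun x hx τ j =>
    (Equiv.sum_comp τ fun u => (fun β => x (u, j, β))).trans ((hWB' x).1 hx j)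
  have sum_WA : ∀ y ∈ WA, ∀ τ : Equiv.Perm (Fin n), ∑ u, (fun β => y (τ u, β)) = 0 :=
    fun y hy τ => (Equiv.sum_comp τ fun u => (fun β => y (u, β))).trans ((hWA' y).1 hy)
  have sum_WA_one : ∀ y ∈ WA, ∑ u, (fun β => y (u, β)) = 0 := fun y hy => (hWA' y).1 hy
  refine ⟨fun x hx => ?_, fun y hy => ?_, ?_⟩
  · rw [hWB']
    intro j
    simp only [Matrix.mulVecLin_apply, NB_mulVec_apply_s6 hinv a σ hσ]
    rw [← Matrix.mulVec_sum, Finset.sum_sub_distrib, Finset.sum_comm, sum_WB x hx,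
      Finset.sum_eq_zero fun i _ => sum_WB x hx _ i, sub_zero, Matrix.mulVec_zero]
  · rw [hWA']
    simp only [Matrix.mulVecLin_apply, Alam_mulVec_apply]
    rw [Finset.sum_add_distrib, Finset.sum_comm, ← Matrix.mulVec_sum, sum_WA_one y hy,
      Matrix.mulVec_zero, zero_add]
    refine Finset.sum_eq_zero fun i _ => ?_
    rw [← Matrix.mulVec_sum, sum_WA y hy, Matrix.mulVec_zero]
  rw [hasEigenvalue_restrict_iff, hasEigenvalue_restrict_iff]
  constructor
  · rintro ⟨x, hxW, hx0, hx⟩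
    let y : Fin n × Fin r → ℂ := fun p => (∑ i, fun β => x ((σ i)⁻¹ p.1, i, β)) p.2
    have edge : ∀ v j, a j *ᵥ ((fun β => y (v, β)) - fun β => x (σ j v, inv j, β)) =
        lam • fun β => x (v, j, β) := by
      intro v j
      rw [← NB_mulVec_apply_s6 hinv a σ hσ]
      funext β
      exact congrFun hx (v, j, β)
    have hxy : ∀ v j, (fun β => x (v, j, β)) =
        (a j * (lam ^ 2 • (1 : Matrix (Fin r) (Fin r) ℂ) - a (inv j) * a j)⁻¹) *ᵥ
          (lam • (fun β => y (v, β)) - a (inv j) *ᵥ fun β => y (σ j v, β)) := by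
      intro v j
      refine eq_mulVec_of_edge_equations (hlam j) (hl j) (edge v j) ?_
      simpa [hσ, hinv j] using edge (σ j v) (inv j)
    refine ⟨y, ?_, ?_, ?_⟩
    · rw [hWA']
      change ∑ u, ∑ i, (fun β => x ((σ i)⁻¹ u, i, β)) = 0
      rw [Finset.sum_comm]
      exact Finset.sum_eq_zero fun i _ => sum_WB x hxW _ i
    · intro hy
      refine hx0 (funext fun ⟨v, j, β⟩ => ?_)
      have hz : ∀ u, (fun β => y (u, β)) = 0 := fun u => funext fun β => congrFun hy (u, β)
      have := congrFun (hxy v j) β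
      simp only [hz, smul_zero, Matrix.mulVec_zero, sub_zero] at this
      exact this
    · rw [zero_smul]
      funext ⟨v, β⟩
      refine congrFun (?_ : (fun β => (Alam n r k inv σ a lam *ᵥ y) (v, β)) = 0) β
      rw [Alam_mulVec_apply_eq_sub, sub_eq_zero]
      refine (Finset.sum_congr rfl fun i _ => ?_ :
        _ = ∑ i, fun β => x ((σ i)⁻¹ v, i, β))
      rw [hxy]
      simp
  · rintro ⟨y, hyW, hy0, hy⟩
    obtain ⟨X, hXy⟩ : ∃ X : Fin n → Fin k → Fin r → ℂ, ∀ v j, X v j =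
        (a j * (lam ^ 2 • (1 : Matrix (Fin r) (Fin r) ℂ) - a (inv j) * a j)⁻¹) *ᵥ
          (lam • (fun β => y (v, β)) - a (inv j) *ᵥ fun β => y (σ j v, β)) :=
      ⟨fun v j => _, fun _ _ => rfl⟩
    have hsum : ∀ v, ∑ i, X ((σ i)⁻¹ v) i = fun β => y (v, β) := by
      intro v
      have h := Alam_mulVec_apply_eq_sub inv a σ lam y v
      have h0 : (fun β => (Alam n r k inv σ a lam *ᵥ y) (v, β)) = 0 := by
        funext β
        simpa using congrFun hy (v, β)
      rw [h0, eq_comm, sub_eq_zero] at h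
      rw [← h]
      exact Finset.sum_congr rfl fun i _ => by simp [hXy]
    refine ⟨fun p => X p.1 p.2.1 p.2.2, ?_, ?_, ?_⟩
    · rw [hWB']
      intro j
      change ∑ u, X u j = 0
      simp only [hXy]
      rw [← Matrix.mulVec_sum, Finset.sum_sub_distrib, ← Finset.smul_sum, ← Matrix.mulVec_sum,
        sum_WA_one y hyW, sum_WA y hyW, smul_zero, Matrix.mulVec_zero, sub_zero,
        Matrix.mulVec_zero]
    · intro hX
      refine hy0 (funext fun ⟨v, β⟩ => ?_)
      have hz : ∀ u j, X u j = 0 := fun u j => funext fun β => congrFun hX (u, j, β)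
      have := congrFun (hsum v) β
      simpa [hz] using this.symm
    · have hB : ∀ v j, (fun β => (NB n r k inv σ (fun _ _ => false) a *ᵥ
          fun p => X p.1 p.2.1 p.2.2) (v, j, β)) = lam • X v j := by
        intro v j
        rw [NB_mulVec_apply_s6 hinv a σ hσ]
        change a j *ᵥ (∑ i, X ((σ i)⁻¹ v) i - X (σ j v) (inv j)) = _
        rw [hsum]
        have := edge_equation (hlam j) (hl j) (fun β => y (v, β)) (fun β => y (σ j v, β))
        simpa [hXy, hσ, hinv j] using this
      funext ⟨v, j, β⟩
      exact congrFun (hB v j) β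
end

section
/- Let n, r, k ≥ 1, inv an involution of Fin k, σ_i permutations of Fin n, and χ_i : Fin n → Bool. Let δ ≥ 0, R ≥ 1, and let a_i, ā_i ∈ Matrix (Fin r) (Fin r) ℂ satisfy ‖a_i‖ ≤ R, ‖ā_i‖ ≤ R, and ‖a_i − ā_i‖ ≤ δ for every i ∈ Fin k, where ‖·‖ is the ℓ²→ℓ² operator norm. Let B := B(σ, χ, a) and B̄ := B(σ, χ, ā) be the corresponding signed nonbacktracking matrices. Then ‖B − B̄‖ ≤ k²·δ, ‖B‖ ≤ k²·R, and for every integer λ ≥ 1, |‖B^λ‖ − ‖B̄^λ‖| ≤ λ·(k²·R)^λ·δ. -/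
open Matrix

/-- The ℓ²→ℓ² operator norm of a square complex matrix. -/
noncomputable def l2OpNorm {ι : Type} [Fintype ι] [DecidableEq ι] (M : Matrix ι ι ℂ) : ℝ :=
  ‖(Matrix.toEuclideanCLM (𝕜 := ℂ) M : EuclideanSpace ℂ ι →L[ℂ] EuclideanSpace ℂ ι)‖

/-- The `EuclideanSpace` vector of the entries of `x` in the block indexed by `(u, i)`. -/
def blockSlice {m k r : Type} (x : EuclideanSpace ℂ (m × k × r)) (u : m) (i : k) :
    EuclideanSpace ℂ r :=
  WithLp.toLp 2 fun α => x (u, i, α)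

lemma norm_sq_eq_sum_blockSlice {m k r : Type} [Fintype m] [Fintype k] [Fintype r]
    (x : EuclideanSpace ℂ (m × k × r)) : ‖x‖ ^ 2 = ∑ u, ∑ i, ‖blockSlice x u i‖ ^ 2 := by
  simp [EuclideanSpace.norm_sq_eq, Fintype.sum_prod_type, blockSlice]

/-- The coefficient with which the block `(σ i).symm v, i` contributes to the block `v, j`
under the nonbacktracking operator. -/
def nbCoeff {n k : ℕ} (inv : Fin k → Fin k) (σ : Fin k → Equiv.Perm (Fin n))
    (χ : Fin k → Fin n → Bool) (v : Fin n) (j i : Fin k) : ℂ :=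
  if j ≠ inv i then (if χ i ((σ i).symm v) then -1 else 1) else 0

lemma norm_nbCoeff_le_one {n k : ℕ} (inv : Fin k → Fin k) (σ : Fin k → Equiv.Perm (Fin n))
    (χ : Fin k → Fin n → Bool) (v : Fin n) (j i : Fin k) : ‖nbCoeff inv σ χ v j i‖ ≤ 1 := by
  unfold nbCoeff
  split_ifs <;> simp

lemma blockSlice_NB {n r k : ℕ} (inv : Fin k → Fin k) (σ : Fin k → Equiv.Perm (Fin n))
    (χ : Fin k → Fin n → Bool) (a : Fin k → Matrix (Fin r) (Fin r) ℂ)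
    (x : EuclideanSpace ℂ (Fin n × Fin k × Fin r)) (v : Fin n) (j : Fin k) :
    blockSlice (toEuclideanCLM (𝕜 := ℂ) (NB n r k inv σ χ a) x) v j =
      toEuclideanCLM (𝕜 := ℂ) (a j)
        (∑ i, nbCoeff inv σ χ v j i • blockSlice x ((σ i).symm v) i) := by
  ext β
  have hv (u : Fin n) (i : Fin k) : v = σ i u ↔ (σ i).symm v = u := by
    rw [Equiv.symm_apply_eq]
  simp only [blockSlice, ofLp_toEuclideanCLM, mulVec, dotProduct, NB, of_apply, nbCoeff,
    WithLp.ofLp_sum, WithLp.ofLp_smul, Finset.sum_apply, Pi.smul_apply, smul_eq_mul,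
    Fintype.sum_prod_type, Finset.mul_sum]
  rw [Finset.sum_comm, Finset.sum_comm (s := Finset.univ (α := Fin r))]
  refine Finset.sum_congr rfl fun i _ => ?_
  rw [Finset.sum_comm]
  refine Finset.sum_congr rfl fun α _ => ?_
  rw [Finset.sum_eq_single ((σ i).symm v)]
  · by_cases h : j = inv i
    · simp [h]
    · simp [h]
  · intro u _ hu
    simp [hv, hu.symm]
  · simp

lemma l2OpNorm_NB_le {n r k : ℕ} (inv : Fin k → Fin k) (σ : Fin k → Equiv.Perm (Fin n))
    (χ : Fin k → Fin n → Bool) {a : Fin k → Matrix (Fin r) (Fin r) ℂ} {C : ℝ} (hC : 0 ≤ C)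
    (ha : ∀ i, l2OpNorm (a i) ≤ C) : l2OpNorm (NB n r k inv σ χ a) ≤ k * C := by
  refine ContinuousLinearMap.opNorm_le_bound _ (by positivity) fun x => ?_
  refine le_of_sq_le_sq ?_ (by positivity)
  have hblock (v : Fin n) (j : Fin k) :
      ‖blockSlice (toEuclideanCLM (𝕜 := ℂ) (NB n r k inv σ χ a) x) v j‖ ^ 2 ≤
        C ^ 2 * (k * ∑ i, ‖blockSlice x ((σ i).symm v) i‖ ^ 2) := by
    rw [blockSlice_NB]
    have hsum : ‖∑ i, nbCoeff inv σ χ v j i • blockSlice x ((σ i).symm v) i‖ ≤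
        ∑ i, ‖blockSlice x ((σ i).symm v) i‖ := by
      refine norm_sum_le_of_le _ fun i _ => ?_
      rw [norm_smul]
      exact mul_le_of_le_one_left (norm_nonneg _) (norm_nbCoeff_le_one ..)
    calc _ ≤ (C * ∑ i, ‖blockSlice x ((σ i).symm v) i‖) ^ 2 := by
          gcongr
          exact ContinuousLinearMap.le_of_opNorm_le_of_le _ (ha j) hsum
      _ ≤ _ := by
          rw [mul_pow]
          gcongr
          simpa using sq_sum_le_card_mul_sum_sq (s := Finset.univ)
            (f := fun i => ‖blockSlice x ((σ i).symm v) i‖)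
  calc _ = ∑ v, ∑ j,
        ‖blockSlice (toEuclideanCLM (𝕜 := ℂ) (NB n r k inv σ χ a) x) v j‖ ^ 2 :=
        norm_sq_eq_sum_blockSlice _
    _ ≤ ∑ v : Fin n, ∑ _j : Fin k,
        C ^ 2 * (k * ∑ i, ‖blockSlice x ((σ i).symm v) i‖ ^ 2) := by
        gcongr
        exact hblock _ _
    _ = (k * C) ^ 2 * ∑ i, ∑ v, ‖blockSlice x ((σ i).symm v) i‖ ^ 2 := by
        rw [Finset.sum_comm (s := Finset.univ (α := Fin k)) (t := Finset.univ (α := Fin n))]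
        simp only [Finset.sum_const, Finset.card_univ, Fintype.card_fin, nsmul_eq_mul,
          Finset.mul_sum]
        refine Finset.sum_congr rfl fun v _ => Finset.sum_congr rfl fun i _ => ?_
        ring
    _ = (k * C * ‖x‖) ^ 2 := by
        rw [mul_pow _ ‖x‖, norm_sq_eq_sum_blockSlice x,
          Finset.sum_comm (s := Finset.univ (α := Fin n))]
        congr 1
        exact Finset.sum_congr rfl fun i _ =>
          Equiv.sum_comp (σ i).symm fun u => ‖blockSlice x u i‖ ^ 2

lemma NB_sub (n r k : ℕ) (inv : Fin k → Fin k) (σ : Fin k → Equiv.Perm (Fin n))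
    (χ : Fin k → Fin n → Bool) (a b : Fin k → Matrix (Fin r) (Fin r) ℂ) :
    NB n r k inv σ χ a - NB n r k inv σ χ b = NB n r k inv σ χ fun i => a i - b i := by
  ext p q
  simp only [NB, Matrix.sub_apply, of_apply]
  split_ifs <;> ring

lemma norm_pow_sub_pow_le {A : Type*} [NormedRing A] [NormOneClass A] {x y : A} {M : ℝ}
    (hx : ‖x‖ ≤ M) (hy : ‖y‖ ≤ M) (m : ℕ) :
    ‖x ^ (m + 1) - y ^ (m + 1)‖ ≤ (m + 1) * M ^ m * ‖x - y‖ := by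
  have hM : 0 ≤ M := (norm_nonneg x).trans hx
  induction m with
  | zero => simp
  | succ m ih =>
    have hsplit : x ^ (m + 1 + 1) - y ^ (m + 1 + 1) =
        x * (x ^ (m + 1) - y ^ (m + 1)) + (x - y) * y ^ (m + 1) := by
      rw [pow_succ' x, pow_succ' y (m + 1)]
      noncomm_ring
    calc _ ≤ ‖x‖ * ‖x ^ (m + 1) - y ^ (m + 1)‖ + ‖x - y‖ * ‖y‖ ^ (m + 1) := by
          rw [hsplit]
          refine (norm_add_le _ _).trans (add_le_add (norm_mul_le _ _) ?_)
          exact (norm_mul_le _ _).trans (by gcongr; exact norm_pow_le _ _)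
      _ ≤ M * ((m + 1) * M ^ m * ‖x - y‖) + ‖x - y‖ * M ^ (m + 1) := by gcongr
      _ = _ := by
          push_cast
          ring

/-- Stability of signed nonbacktracking operators under perturbations of the
coefficients: nearby coefficient families (in ℓ²→ℓ² operator norm) give nearby signed
nonbacktracking matrices, with `‖B − B̄‖ ≤ k²δ`, `‖B‖ ≤ k²R`, and
`|‖B^λ‖ − ‖B̄^λ‖| ≤ λ·(k²R)^λ·δ` for every integer `λ ≥ 1`. -/
theorem stmt_9 (n r k : ℕ) (hn : 1 ≤ n) (hr : 1 ≤ r) (hk : 1 ≤ k)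
    (inv : Fin k → Fin k) (hinv : Function.Involutive inv)
    (σ : Fin k → Equiv.Perm (Fin n)) (χ : Fin k → Fin n → Bool)
    (δ R : ℝ) (hδ : 0 ≤ δ) (hR : 1 ≤ R)
    (a abar : Fin k → Matrix (Fin r) (Fin r) ℂ)
    (ha : ∀ i, l2OpNorm (a i) ≤ R) (habar : ∀ i, l2OpNorm (abar i) ≤ R)
    (hdiff : ∀ i, l2OpNorm (a i - abar i) ≤ δ) :
    l2OpNorm (NB n r k inv σ χ a - NB n r k inv σ χ abar) ≤ (k : ℝ) ^ 2 * δ ∧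
      l2OpNorm (NB n r k inv σ χ a) ≤ (k : ℝ) ^ 2 * R ∧
      ∀ lam : ℕ, 1 ≤ lam →
        |l2OpNorm (NB n r k inv σ χ a ^ lam) - l2OpNorm (NB n r k inv σ χ abar ^ lam)| ≤
          (lam : ℝ) * ((k : ℝ) ^ 2 * R) ^ lam * δ := by
  have hk' : (1 : ℝ) ≤ k := by exact_mod_cast hk
  have hkk : (k : ℝ) ≤ (k : ℝ) ^ 2 := le_self_pow₀ hk' two_ne_zero
  have hR0 : 0 ≤ R := zero_le_one.trans hR
  have hbound {c : Fin k → Matrix (Fin r) (Fin r) ℂ} {C : ℝ} (hC : 0 ≤ C)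
      (hc : ∀ i, l2OpNorm (c i) ≤ C) : l2OpNorm (NB n r k inv σ χ c) ≤ (k : ℝ) ^ 2 * C :=
    (l2OpNorm_NB_le inv σ χ hC hc).trans (by gcongr)
  have hsub : l2OpNorm (NB n r k inv σ χ a - NB n r k inv σ χ abar) ≤ (k : ℝ) ^ 2 * δ := by
    rw [NB_sub]
    exact hbound hδ hdiff
  refine ⟨hsub, hbound hR0 ha, fun lam hlam => ?_⟩
  obtain ⟨m, rfl⟩ := Nat.exists_eq_add_of_le' hlam
  have : Nonempty (Fin n × Fin k × Fin r) := ⟨⟨0, hn⟩, ⟨0, hk⟩, ⟨0, hr⟩⟩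
  have hpow := norm_pow_sub_pow_le (hbound hR0 ha) (hbound hR0 habar) m
  rw [← map_sub] at hpow
  simp only [l2OpNorm, map_pow]
  calc _ ≤ (m + 1) * ((k : ℝ) ^ 2 * R) ^ m * _ := (abs_norm_sub_norm_le _ _).trans hpow
    _ ≤ (m + 1) * ((k : ℝ) ^ 2 * R) ^ m * ((k : ℝ) ^ 2 * R * δ) := by
        gcongr
        exact hsub.trans (by gcongr; exact le_mul_of_one_le_right (by positivity) hR)
    _ = _ := by
        push_cast
        ring
end

section
/- Let α be a finite type and let T be a finite subset of the free group FreeGroup α that is closed under inverses (T⁻¹ = T). Then the language over the alphabet α × Bool consisting of all reduced words l (i.e., lists l : List (α × Bool) satisfying FreeGroup.reduce l = l, equivalently l is the canonical reduced word of the element FreeGroup.mk l) whose group element FreeGroup.mk l belongs to the subgroup of FreeGroup α generated by T, is a regular language: it is accepted by a deterministic finite automaton with finitely many states. -/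
/-- The left quotient, by a word with last letter `o` lying in the right coset of `q`, of the
language of reduced words representing elements of `H`. -/
def reducedQuotient {α : Type} (H : Subgroup (FreeGroup α)) (o : Option (α × Bool))
    (q : List (α × Bool)) : Language (α × Bool) :=
  {y | FreeGroup.IsReduced y ∧ (∀ a ∈ o, ∀ b ∈ y.head?, a.1 = b.1 → a.2 = b.2) ∧
    FreeGroup.mk q * FreeGroup.mk y ∈ H}

theorem List.IsPrefix.of_append {β : Type*} {p a b : List β} (h : p <+: a ++ b) :
    p <+: a ∨ ∃ s, p = a ++ s ∧ s <+: b := by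
  rcases List.prefix_or_prefix_of_prefix h (List.prefix_append a b) with h' | ⟨s, rfl⟩
  · exact Or.inl h'
  · exact Or.inr ⟨s, rfl, (List.prefix_append_right_inj a).mp h⟩

/-- All prefixes of `w` represent elements of `K`. -/
def PrefixesIn {α : Type} (K : Set (FreeGroup α)) (w : List (α × Bool)) : Prop :=
  ∀ p, p <+: w → FreeGroup.mk p ∈ K

theorem PrefixesIn.step {α : Type} {K : Set (FreeGroup α)} {v w : List (α × Bool)}
    (h : FreeGroup.Red.Step v w) (hv : PrefixesIn K v) : PrefixesIn K w := by
  obtain @⟨a, b, x, c⟩ := h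
  intro p hp
  rcases hp.of_append with h | ⟨s, rfl, hs⟩
  · exact hv p (h.trans (List.prefix_append _ _))
  · have := hv (a ++ (x, c) :: (x, !c) :: s)
      ((List.prefix_append_right_inj a).mpr (by simpa using hs))
    have e : FreeGroup.mk (a ++ (x, c) :: (x, !c) :: s) = FreeGroup.mk (a ++ s) :=
      Quot.sound FreeGroup.Red.Step.not
    rwa [e] at this

theorem PrefixesIn.red {α : Type} {K : Set (FreeGroup α)} {v w : List (α × Bool)}
    (h : FreeGroup.Red v w) (hv : PrefixesIn K v) : PrefixesIn K w := by
  induction h with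
  | refl => exact hv
  | tail _ h ih => exact ih.step h

/-- If `K` contains all prefixes of the elements of `T` and is stable under left multiplication by
`T`, then it contains all prefixes of the reduced words of the subgroup generated by `T`. -/
theorem PrefixesIn.toWord_of_mem_closure {α : Type} [DecidableEq α] {T K : Set (FreeGroup α)}
    (hT : ∀ t ∈ T, t⁻¹ ∈ T) (h_one : 1 ∈ K) (hK : ∀ t ∈ T, PrefixesIn K t.toWord)
    (h_mul : ∀ t ∈ T, ∀ g ∈ K, t * g ∈ K) {g : FreeGroup α} (hg : g ∈ Subgroup.closure T) :
    PrefixesIn K g.toWord := by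
  have key : ∀ t ∈ T, ∀ y : FreeGroup α, PrefixesIn K y.toWord →
      PrefixesIn K (t * y).toWord := by
    intro t ht y hy
    rw [FreeGroup.toWord_mul]
    refine PrefixesIn.red FreeGroup.reduce.red fun p hp => ?_
    rcases hp.of_append with h | ⟨s, rfl, hs⟩
    · exact hK t ht p h
    · rw [← FreeGroup.mul_mk, FreeGroup.mk_toWord]
      exact h_mul t ht _ (hy s hs)
  induction hg using Subgroup.closure_induction_left with
  | one =>
    intro p hp
    rw [FreeGroup.toWord_one, List.prefix_nil] at hp
    subst hp
    exact h_one
  | mul_left t ht y _ ih => exact key t ht y ih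
  | inv_mul_cancel t ht y _ ih => exact key _ (hT t ht) y ih

/-- (Stallings foldings.) For a finite inverse-closed subset `T` of a free
group on a finite alphabet, the language of reduced words whose group element lies in the
subgroup generated by `T` is regular: it is accepted by a DFA with finitely many states. -/
theorem stmt_11 (α : Type) [Fintype α] [DecidableEq α] (T : Finset (FreeGroup α))
    (hT : ∀ t ∈ T, t⁻¹ ∈ T) :
    Language.IsRegular
      ({l : List (α × Bool) | FreeGroup.reduce l = l ∧
          FreeGroup.mk l ∈ Subgroup.closure (T : Set (FreeGroup α))} :
        Language (α × Bool)) := by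
  set H := Subgroup.closure (T : Set (FreeGroup α))
  let Q : Set (List (α × Bool)) := {[]} ∪ ⋃ t ∈ T, {q | q ∈ t.toWord.inits}
  have hQ : Q.Finite := (Set.finite_singleton _).union
    (T.finite_toSet.biUnion fun t _ => List.finite_toSet _)
  let K : Set (FreeGroup α) := {g | ∃ h ∈ H, ∃ q ∈ Q, g = h * FreeGroup.mk q}
  have hK : ∀ g ∈ H, PrefixesIn K g.toWord := by
    intro g hg
    refine PrefixesIn.toWord_of_mem_closure (K := K) hT
      ⟨1, H.one_mem, [], Or.inl rfl, (one_mul _).symm⟩ ?_ ?_ hg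
    · intro t ht p hp
      exact ⟨1, H.one_mem, p,
        Or.inr (Set.mem_biUnion ht ((List.mem_inits _ _).mpr hp)), (one_mul _).symm⟩
    · rintro t ht _ ⟨h, hh, q, hq, rfl⟩
      exact ⟨t * h, H.mul_mem (Subgroup.subset_closure ht) hh, q, hq, (mul_assoc _ _ _).symm⟩
  refine Language.IsRegular.of_finite_range_leftQuotient
    (((Set.finite_singleton (∅ : Set (List (α × Bool)))).union
      (Set.Finite.image2 (reducedQuotient H) Set.finite_univ hQ)).subset ?_)
  rintro _ ⟨x, rfl⟩
  rcases Set.eq_empty_or_nonempty (α := List (α × Bool))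
    (Language.leftQuotient {l | FreeGroup.reduce l = l ∧ FreeGroup.mk l ∈ H} x) with h | ⟨y, hy⟩
  · exact Or.inl h
  · obtain ⟨hy₁, hy₂⟩ : FreeGroup.reduce (x ++ y) = x ++ y ∧ FreeGroup.mk (x ++ y) ∈ H := hy
    have hx : FreeGroup.IsReduced x :=
      (List.isChain_append.mp (FreeGroup.isReduced_iff_reduce_eq.mpr hy₁)).1
    obtain ⟨h, hh, q, hq, hxq⟩ := hK _ hy₂ x (by
      rw [FreeGroup.toWord_mk, hy₁]; exact List.prefix_append _ _)
    refine Or.inr ⟨x.getLast?, Set.mem_univ _, q, hq, ?_⟩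
    ext z
    change _ ↔ FreeGroup.reduce (x ++ z) = x ++ z ∧ FreeGroup.mk (x ++ z) ∈ H
    rw [← FreeGroup.isReduced_iff_reduce_eq, ← FreeGroup.mul_mk, hxq, mul_assoc,
      H.mul_mem_cancel_left hh, FreeGroup.IsReduced, List.isChain_append, ← FreeGroup.IsReduced]
    exact ⟨fun ⟨h₁, h₂, h₃⟩ => ⟨⟨hx, h₁, h₂⟩, h₃⟩, fun ⟨⟨_, h₁, h₂⟩, h₃⟩ => ⟨h₁, h₂, h₃⟩⟩
end

section
/- Let V∞ be the free product of d copies of ℤ/2ℤ and e copies of ℤ, let r ≥ 1, and let a : V∞ → Matrix (Fin r) (Fin r) ℂ be finitely supported and self-adjoint (a(g⁻¹) = (a g)ᴴ for all g). Let X(a) be the extension graph of the ∞-lift. Let Γ be the free product (coproduct of groups) of V∞ with the free group FreeGroup (Fin r), with inclusions inl : V∞ → Γ and inr : FreeGroup (Fin r) → Γ, and write h_α := inr (FreeGroup.of α). Then for all u, v ∈ V∞ and i, j ∈ Fin r, the vertices (u,i) and (v,j) lie in the same connected component of X(a) (i.e., are reachable from one another) if and only if the element h_j · inl(v·u⁻¹)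 · h_i⁻¹ of Γ belongs to the subgroup of Γ generated by the set { h_β · inl(g) · h_α⁻¹ : g ∈ V∞, α, β ∈ Fin r, (a g)_{β,α} ≠ 0 }. -/
open Matrix

/-- The family of groups consisting of `d` copies of `ℤ/2ℤ` and `e` copies of `ℤ`. -/
def Gfam (d e : ℕ) : Fin d ⊕ Fin e → Type := fun i =>
  Sum.elim (fun _ => Multiplicative (ZMod 2)) (fun _ => Multiplicative ℤ) i

instance (d e : ℕ) : (i : Fin d ⊕ Fin e) → Group (Gfam d e i)
  | Sum.inl _ => inferInstanceAs (Group (Multiplicative (ZMod 2)))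
  | Sum.inr _ => inferInstanceAs (Group (Multiplicative ℤ))

/-- `V∞`, the free product of `d` copies of `ℤ/2ℤ` and `e` copies of `ℤ`. -/
def Vinf (d e : ℕ) : Type := Monoid.CoprodI (Gfam d e)

instance (d e : ℕ) : Group (Vinf d e) :=
  inferInstanceAs (Group (Monoid.CoprodI (Gfam d e)))

/-- The extension graph `X(a)` of the `∞`-lift: vertices `V∞ × Fin r`, with `(u,i)` adjacent to
`(v,j)` iff they are distinct and `(a (v·u⁻¹))_{j,i} ≠ 0` (symmetrized; for self-adjoint `a` the
symmetrization is the relation itself). -/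
def extGraph (d e r : ℕ) (a : Vinf d e → Matrix (Fin r) (Fin r) ℂ) :
    SimpleGraph (Vinf d e × Fin r) :=
  SimpleGraph.fromRel fun x y => a (y.1 * x.1⁻¹) y.2 x.2 ≠ 0

open Monoid.Coprod in
/-- The element `h_j · g · h_i⁻¹` of the free product `G ∗ FreeGroup ι`. -/
def connector {G ι : Type*} [Group G] (g : G) (i j : ι) : Monoid.Coprod G (FreeGroup ι) :=
  inr (FreeGroup.of j) * inl g * (inr (FreeGroup.of i))⁻¹

theorem connector_one {G ι : Type*} [Group G] (i : ι) : connector (1 : G) i i = 1 := by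
  simp [connector]

theorem connector_mul {G ι : Type*} [Group G] (g h : G) (i j k : ι) :
    connector h j k * connector g i j = connector (h * g) i k := by
  simp [connector, mul_assoc]

theorem connector_inv {G ι : Type*} [Group G] (g : G) (i j : ι) :
    (connector g i j)⁻¹ = connector g⁻¹ j i := by
  simp [connector, mul_assoc]

/-- The graph on `G × ι` with an edge from `(u, i)` to `(v, j)` whenever `A (v * u⁻¹) j i`. -/
def cayleyGraph {G ι : Type*} [Group G] (A : G → ι → ι → Prop) : SimpleGraph (G × ι) :=
  SimpleGraph.fromRel fun x y => A (y.1 * x.1⁻¹) y.2 x.2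

section

variable {G ι : Type*} [Group G] (A : G → ι → ι → Prop)

/-- Right translation by `w⁻¹` as an endomorphism of `cayleyGraph A`. -/
def cayleyTranslate (w : G) : cayleyGraph A →g cayleyGraph A where
  toFun x := (x.1 * w⁻¹, x.2)
  map_rel' := by
    rintro ⟨u, i⟩ ⟨v, j⟩ h
    simpa [cayleyGraph, SimpleGraph.fromRel_adj, mul_assoc] using h

/-- The action of `G` by right translations on the connected components of `cayleyGraph A`
together with an additional fixed point `none`. -/
def componentAction : G →* Equiv.Perm (Option (cayleyGraph A).ConnectedComponent) :=
  MonoidHom.toHomPerm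
    { toFun := fun w => Option.map (SimpleGraph.ConnectedComponent.map (cayleyTranslate A w))
      map_one' := by
        funext x
        rcases x with _ | c
        · rfl
        · induction c using SimpleGraph.ConnectedComponent.ind
          simp [cayleyTranslate, Function.End.one_def]
      map_mul' := by
        intro g h
        funext x
        rcases x with _ | c
        · rfl
        · induction c using SimpleGraph.ConnectedComponent.ind with | h x
          change some ((cayleyGraph A).connectedComponentMk (x.1 * (g * h)⁻¹, x.2)) =
            some ((cayleyGraph A).connectedComponentMk (x.1 * h⁻¹ * g⁻¹, x.2))
          rw [_root_.mul_inv_rev, mul_assoc] }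

theorem componentAction_some (w u : G) (i : ι) :
    componentAction A w (some ((cayleyGraph A).connectedComponentMk (u, i))) =
      some ((cayleyGraph A).connectedComponentMk (u * w⁻¹, i)) :=
  rfl

open Classical in
/-- The extension of `componentAction` to `G ∗ FreeGroup ι` in which the generator `h_i` swaps
the component of `(1, i)` with the additional point. -/
noncomputable def freeProductAction :
    Monoid.Coprod G (FreeGroup ι) →* Equiv.Perm (Option (cayleyGraph A).ConnectedComponent) :=
  Monoid.Coprod.lift (componentAction A) (FreeGroup.lift fun i =>
    Equiv.swap (some ((cayleyGraph A).connectedComponentMk (1, i))) none)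

theorem reachable_mul_right {x y : G × ι} (h : (cayleyGraph A).Reachable x y) (w : G) :
    (cayleyGraph A).Reachable (x.1 * w, x.2) (y.1 * w, y.2) := by
  simpa [cayleyTranslate] using h.map (cayleyTranslate A w⁻¹)

theorem freeProductAction_connector_none (u v : G) (i j : ι) :
    freeProductAction A (connector (v * u⁻¹) i j) none = none ↔
      (cayleyGraph A).Reachable (u, i) (v, j) := by
  classical
  have key : freeProductAction A (connector (v * u⁻¹) i j) none = none ↔
      (cayleyGraph A).Reachable (u * v⁻¹, i) (1, j) := by
    simp only [freeProductAction, connector, map_mul, map_inv, Monoid.Coprod.lift_apply_inl,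
      Monoid.Coprod.lift_apply_inr, FreeGroup.lift_apply_of, Equiv.swap_inv, Equiv.Perm.mul_apply,
      Equiv.swap_apply_right, Equiv.swap_apply_eq_iff]
    rw [← map_inv, componentAction_some, componentAction_some, Option.some_inj,
      SimpleGraph.ConnectedComponent.eq]
    simp
  rw [key]
  constructor
  · intro h
    simpa using reachable_mul_right A h v
  · intro h
    simpa using reachable_mul_right A h v⁻¹

/-- The subgroup of `G ∗ FreeGroup ι` generated by the elements `h_β · g · h_α⁻¹` with
`A g β α`. -/
def connectorSubgroup : Subgroup (Monoid.Coprod G (FreeGroup ι)) :=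
  Subgroup.closure
    {x : Monoid.Coprod G (FreeGroup ι) | ∃ (g : G) (α β : ι), A g β α ∧ x = connector g α β}

variable {A} in
theorem connector_mem {g : G} {α β : ι} (h : A g β α) :
    connector g α β ∈ connectorSubgroup A :=
  Subgroup.subset_closure ⟨g, α, β, h, rfl⟩

theorem reachable_cayleyGraph_iff (u v : G) (i j : ι) :
    (cayleyGraph A).Reachable (u, i) (v, j) ↔
      connector (v * u⁻¹) i j ∈ connectorSubgroup A := by
  constructor
  · suffices H : ∀ x y : G × ι, (cayleyGraph A).Walk x y →
        connector (y.1 * x.1⁻¹) x.2 y.2 ∈ connectorSubgroup A by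
      rintro ⟨p⟩
      exact H (u, i) (v, j) p
    intro x y p
    induction p with
    | nil => simp [connector_one]
    | @cons x y z hxy _ ih =>
      have hmul := connector_mul (y.1 * x.1⁻¹) (z.1 * y.1⁻¹) x.2 y.2 z.2
      rw [show z.1 * y.1⁻¹ * (y.1 * x.1⁻¹) = z.1 * x.1⁻¹ by group] at hmul
      rw [← hmul]
      refine mul_mem ih ?_
      rcases ((SimpleGraph.fromRel_adj _ _ _).1 hxy).2 with h | h
      · exact connector_mem h
      · rw [← inv_mem_iff, connector_inv]
        exact connector_mem (by simpa using h)
  · intro h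
    rw [← freeProductAction_connector_none]
    have hle : connectorSubgroup A ≤
        (MulAction.stabilizer (Equiv.Perm (Option (cayleyGraph A).ConnectedComponent))
          (none : Option (cayleyGraph A).ConnectedComponent)).comap (freeProductAction A) := by
      rw [connectorSubgroup, Subgroup.closure_le]
      rintro _ ⟨g, α, β, hA, rfl⟩
      have hr : (cayleyGraph A).Reachable (1, α) (g, β) := by
        by_cases hne : ((1 : G), α) = (g, β)
        · rw [hne]
        · exact SimpleGraph.Adj.reachable
            ((SimpleGraph.fromRel_adj _ _ _).2 ⟨hne, Or.inl (by simpa using hA)⟩)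
      simpa using (freeProductAction_connector_none A 1 g α β).2 hr
    exact hle h

end

/-- Connectivity in the extension graph of an `∞`-lift is decided by subgroup
membership in the free product `Γ = V∞ ∗ FreeGroup (Fin r)`: the vertices `(u,i)` and `(v,j)`
are in the same connected component of `X(a)` iff `h_j · inl(v·u⁻¹) · h_i⁻¹` lies in the
subgroup of `Γ` generated by `{h_β · inl(g) · h_α⁻¹ : (a g)_{β,α} ≠ 0}`. -/
theorem stmt_12 (d e r : ℕ) (hr : 1 ≤ r)
    (a : Vinf d e → Matrix (Fin r) (Fin r) ℂ)
    (hfin : {g : Vinf d e | a g ≠ 0}.Finite)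
    (hsa : ∀ g : Vinf d e, a g⁻¹ = (a g)ᴴ)
    (u v : Vinf d e) (i j : Fin r) :
    (extGraph d e r a).Reachable (u, i) (v, j) ↔
      (Monoid.Coprod.inr (FreeGroup.of j) :
            Monoid.Coprod (Vinf d e) (FreeGroup (Fin r))) *
          Monoid.Coprod.inl (v * u⁻¹) * (Monoid.Coprod.inr (FreeGroup.of i))⁻¹ ∈
        Subgroup.closure
          {x : Monoid.Coprod (Vinf d e) (FreeGroup (Fin r)) |
            ∃ (g : Vinf d e) (α β : Fin r), a g β α ≠ 0 ∧
              x = Monoid.Coprod.inr (FreeGroup.of β) * Monoid.Coprod.inl g *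
                (Monoid.Coprod.inr (FreeGroup.of α))⁻¹} := by
  exact reachable_cayleyGraph_iff (fun g β α => a g β α ≠ 0) u v i j
end

section
/- Let V∞ be the free product of d copies of ℤ/2ℤ and e copies of ℤ, let r ≥ 1, and let a : V∞ → Matrix (Fin r) (Fin r) ℂ be finitely supported and self-adjoint. Let m := Σ_{g ∈ supp(a)} ℓ_S(g), the sum of the generator-word-lengths of the group elements in the support of a. Then the extension graph X(a) admits a tree decomposition all of whose bags have cardinality at most (m+1)·r; that is, there exist a simple graph 𝒯 on some vertex type that is a tree (connected and acyclic) and a map W from the vertices of 𝒯 to finite sets of vertices of X(a) such that: (i) every vertex of X(a) belongs to some bag W(t); (ii) for every edge {x,y} of X(a) there is a bag W(t) containing both x and y; (iii) for every vertex x of X(a) and all t₁, t₂ with x ∈ W(t₁) and x ∈ W(t₂), every vertex on any path in 𝒯 from t₁ to t₂ has its bag containing x; and (iv) |W(t)| ≤ (m+1)·r for every t. In particular the treewidth of X(a) is at most (m+1)·r. -/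
open Matrix

/-- The standard symmetric generating set of `V∞`: the nontrivial element of each `ℤ/2ℤ` factor
together with the generators `±1` of each `ℤ` factor. -/
def stdGen (d e : ℕ) : Set (Vinf d e) :=
  (Set.range fun i : Fin d =>
      (Monoid.CoprodI.of (M := Gfam d e) (i := Sum.inl i)
        (show Gfam d e (Sum.inl i) from Multiplicative.ofAdd (1 : ZMod 2)) : Vinf d e)) ∪
  (Set.range fun i : Fin e =>
      (Monoid.CoprodI.of (M := Gfam d e) (i := Sum.inr i)
        (show Gfam d e (Sum.inr i) from Multiplicative.ofAdd (1 : ℤ)) : Vinf d e)) ∪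
  (Set.range fun i : Fin e =>
      ((Monoid.CoprodI.of (M := Gfam d e) (i := Sum.inr i)
        (show Gfam d e (Sum.inr i) from Multiplicative.ofAdd (1 : ℤ)) : Vinf d e))⁻¹)

/-- The word length `ℓ_S(g)`: the least `m` such that `g` is a product of `m` standard
generators. -/
noncomputable def wordLen (d e : ℕ) (g : Vinf d e) : ℕ :=
  sInf {m : ℕ | ∃ f : Fin m → Vinf d e, (∀ s, f s ∈ stdGen d e) ∧ (List.ofFn f).prod = g}

open Monoid.CoprodI in
/-- The total weight of a reduced word whose letters are weighted by `N`. -/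
def Monoid.CoprodI.Word.weight {ι : Type*} {M : ι → Type*} [∀ i, Monoid (M i)]
    (N : ∀ i, M i → ℕ) (w : Word M) : ℕ :=
  (w.toList.map fun x => N x.1 x.2).sum

namespace Monoid.CoprodI.Word

variable {ι : Type*} {M : ι → Type*} [∀ i, Monoid (M i)] [∀ i, DecidableEq (M i)]
  {N : ∀ i, M i → ℕ}

theorem weight_rcons (hN : ∀ i, N i 1 = 0) {i : ι} (p : Pair M i) :
    (rcons p).weight N = N i p.head + p.tail.weight N := by
  by_cases h : p.head = 1
  · simp [rcons, h, hN]
  · simp [rcons, h, weight, cons]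

variable [DecidableEq ι]

theorem weight_eq_equivPair (hN : ∀ i, N i 1 = 0) (i : ι) (w : Word M) :
    w.weight N = N i (equivPair i w).head + (equivPair i w).tail.weight N := by
  rw [← weight_rcons hN, ← equivPair_symm, Equiv.symm_apply_apply]

theorem weight_of_smul (hN : ∀ i, N i 1 = 0) {i : ι} (m : M i) (w : Word M) :
    (of m • w).weight N =
      N i (m * (equivPair i w).head) + (equivPair i w).tail.weight N := by
  rw [of_smul_def, weight_rcons hN]

theorem fstIdx_eq_of_equivPair_head_ne_one {i : ι} {w : Word M}
    (h : (equivPair i w).head ≠ 1) : w.fstIdx = some i := by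
  by_contra hne
  exact h (by rw [equivPair_eq_of_fstIdx_ne hne])

end Monoid.CoprodI.Word

namespace SimpleGraph

variable {V : Type*} {G : SimpleGraph V}

/-- A graph is acyclic if it has a height function that differs across every edge and such that
each vertex has at most one neighbour of smaller height. -/
theorem isAcyclic_of_height (h : V → ℕ) (hne : ∀ u v, G.Adj u v → h u ≠ h v)
    (huniq : ∀ u v w, G.Adj u v → G.Adj u w → h v < h u → h w < h u → v = w) :
    G.IsAcyclic := by
  classical
  intro v c hc
  obtain ⟨u, hu, hmax⟩ := c.support.toFinset.exists_max_image h ⟨v, by simp⟩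
  rw [List.mem_toFinset] at hu
  have hc' := hc.rotate hu
  have hlt : ∀ w ∈ (c.rotate u hu).support, G.Adj u w → h w < h u := fun w hw hadj =>
    lt_of_le_of_ne (hmax w (by simpa using hw)) (hne u w hadj).symm
  have hs := (c.rotate u hu).adj_snd hc'.not_nil
  have hp := ((c.rotate u hu).adj_penultimate hc'.not_nil).symm
  exact hc'.snd_ne_penultimate (huniq u _ _ hs hp (hlt _ (Walk.getVert_mem_support _ _) hs)
    (hlt _ (Walk.getVert_mem_support _ _) hp))

theorem IsAcyclic.support_subset_of_isPath (hG : G.IsAcyclic) {u v : V} {p : G.Walk u v}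
    (hp : p.IsPath) (q : G.Walk u v) : p.support ⊆ q.support := by
  classical
  have h : p = q.bypass := congrArg Subtype.val
    ((hG.subsingleton_path u v).elim ⟨p, hp⟩ ⟨_, q.bypass_isPath⟩)
  rw [h]
  exact q.support_bypass_subset_support

end SimpleGraph

/-- The absolute value on a factor `ℤ/2ℤ` or `ℤ`. -/
def factorNorm {d e : ℕ} : ∀ i : Fin d ⊕ Fin e, Gfam d e i → ℕ
  | Sum.inl _, x => ZMod.val (n := 2) (Multiplicative.toAdd (α := ZMod 2) x)
  | Sum.inr _, x => Int.natAbs (Multiplicative.toAdd (α := ℤ) x)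

section FactorNorm

variable {d e : ℕ}

theorem factorNorm_one (i : Fin d ⊕ Fin e) : factorNorm i (1 : Gfam d e i) = 0 := by
  rcases i with i | i <;> rfl

theorem factorNorm_inv {i : Fin d ⊕ Fin e} (s : Gfam d e i) :
    factorNorm i s⁻¹ = factorNorm i s := by
  rcases i with i | i
  · change ZMod 2 at s
    change ZMod.val (-s) = ZMod.val s
    revert s; decide
  · exact Int.natAbs_neg _

theorem factorNorm_mul_ne {i : Fin d ⊕ Fin e} {s : Gfam d e i} (hs : factorNorm i s = 1)
    (h : Gfam d e i) : factorNorm i (s * h) ≠ factorNorm i h := by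
  rcases i with i | i
  · change ZMod 2 at s h
    change ZMod.val s = 1 at hs
    change ZMod.val (s + h) ≠ ZMod.val h
    revert s h; decide
  · change ℤ at s h
    change Int.natAbs s = 1 at hs
    change Int.natAbs (s + h) ≠ Int.natAbs h
    omega

theorem eq_of_factorNorm_mul_lt {i : Fin d ⊕ Fin e} {s t h : Gfam d e i}
    (hs : factorNorm i s = 1) (ht : factorNorm i t = 1)
    (hsh : factorNorm i (s * h) < factorNorm i h)
    (hth : factorNorm i (t * h) < factorNorm i h) : s = t := by
  rcases i with i | i
  · change ZMod 2 at s t h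
    change ZMod.val s = 1 at hs
    change ZMod.val t = 1 at ht
    clear hsh hth
    change (s : ZMod 2) = t
    revert s t; decide
  · change ℤ at s t h
    change Int.natAbs s = 1 at hs
    change Int.natAbs t = 1 at ht
    change Int.natAbs (s + h) < Int.natAbs h at hsh
    change Int.natAbs (t + h) < Int.natAbs h at hth
    change (s : ℤ) = t
    omega

theorem exists_factorNorm_mul_lt {i : Fin d ⊕ Fin e} {h : Gfam d e i} (hh : h ≠ 1) :
    ∃ s : Gfam d e i, factorNorm i s = 1 ∧ factorNorm i (s * h) < factorNorm i h := by
  rcases i with i | i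
  · change ZMod 2 at h
    change (h : ZMod 2) ≠ 0 at hh
    change ∃ s : ZMod 2, ZMod.val s = 1 ∧ ZMod.val (s + h) < ZMod.val h
    revert h; decide
  · change ℤ at h
    change (h : ℤ) ≠ 0 at hh
    change ∃ s : ℤ, Int.natAbs s = 1 ∧ Int.natAbs (s + h) < Int.natAbs h
    rcases lt_or_gt_of_ne hh with h' | h'
    · exact ⟨1, by omega, by omega⟩
    · exact ⟨-1, by omega, by omega⟩

/-- The inclusion of a factor into `V∞`. -/
def vinfOf (i : Fin d ⊕ Fin e) : Gfam d e i →* Vinf d e :=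
  Monoid.CoprodI.of

theorem mem_stdGen_iff {g : Vinf d e} :
    g ∈ stdGen d e ↔ ∃ (i : Fin d ⊕ Fin e) (s : Gfam d e i),
      factorNorm i s = 1 ∧ g = vinfOf i s := by
  constructor
  · rintro ((⟨i, rfl⟩ | ⟨i, rfl⟩) | ⟨i, rfl⟩)
    · exact ⟨Sum.inl i, _, rfl, rfl⟩
    · exact ⟨Sum.inr i, _, rfl, rfl⟩
    · exact ⟨Sum.inr i, (show Gfam d e (Sum.inr i) from Multiplicative.ofAdd (1 : ℤ))⁻¹, rfl,
        (map_inv (vinfOf (d := d) (Sum.inr i)) _).symm⟩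
  · rintro ⟨i | i, s, hs, rfl⟩
    · refine Or.inl (Or.inl ⟨i, congrArg _ ?_⟩)
      change ZMod 2 at s
      change ZMod.val s = 1 at hs
      change (1 : ZMod 2) = s
      revert s; decide
    · change Int.natAbs s = 1 at hs
      rcases Int.natAbs_eq_iff.mp hs with h | h
      · exact Or.inl (Or.inr ⟨i, congrArg _ h.symm⟩)
      · refine Or.inr ⟨i, ?_⟩
        refine (map_inv (vinfOf (d := d) (Sum.inr i)) _).symm.trans ?_
        exact congrArg _ h.symm

theorem inv_mem_stdGen {g : Vinf d e} (hg : g ∈ stdGen d e) : g⁻¹ ∈ stdGen d e := by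
  obtain ⟨i, s, hs, rfl⟩ := mem_stdGen_iff.mp hg
  exact mem_stdGen_iff.mpr ⟨i, s⁻¹, (factorNorm_inv s).trans hs, (map_inv (vinfOf i) s).symm⟩

end FactorNorm

open scoped Classical in
/-- The total weight of the reduced word representing an element of `V∞`. -/
noncomputable def vinfWeight {d e : ℕ} (g : Vinf d e) : ℕ :=
  (Monoid.CoprodI.Word.equiv (M := Gfam d e) g).weight factorNorm

section VinfWeight

open Monoid.CoprodI

variable {d e : ℕ}

open scoped Classical in
theorem exists_word_weight (u : Vinf d e) : ∃ w : Word (Gfam d e),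
    w.prod = u ∧ vinfWeight u = w.weight factorNorm ∧
    ∀ (i : Fin d ⊕ Fin e) (s : Gfam d e i),
      vinfWeight (vinfOf i s * u) = (of s • w).weight factorNorm :=
  ⟨Word.equiv (M := Gfam d e) u, Word.equiv.symm_apply_apply u, rfl,
    fun _ s => congrArg (Word.weight factorNorm) (mul_smul (of s) (u : Monoid.CoprodI (Gfam d e))
      (Word.empty : Word (Gfam d e)))⟩

theorem vinfWeight_mul_ne {s : Vinf d e} (hs : s ∈ stdGen d e) (u : Vinf d e) :
    vinfWeight (s * u) ≠ vinfWeight u := by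
  classical
  obtain ⟨i, s, hs1, rfl⟩ := mem_stdGen_iff.mp hs
  obtain ⟨w, -, hw, hsw⟩ := exists_word_weight u
  rw [hsw, hw, Word.weight_of_smul factorNorm_one, Word.weight_eq_equivPair factorNorm_one i w]
  have := factorNorm_mul_ne hs1 (Word.equivPair i w).head
  omega

theorem eq_of_vinfWeight_mul_lt {s t u : Vinf d e} (hs : s ∈ stdGen d e) (ht : t ∈ stdGen d e)
    (hsu : vinfWeight (s * u) < vinfWeight u) (htu : vinfWeight (t * u) < vinfWeight u) :
    s = t := by
  classical
  obtain ⟨i, s, hs1, rfl⟩ := mem_stdGen_iff.mp hs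
  obtain ⟨j, t, ht1, rfl⟩ := mem_stdGen_iff.mp ht
  obtain ⟨w, -, hw, hsw⟩ := exists_word_weight u
  rw [hsw, hw, Word.weight_of_smul factorNorm_one,
    Word.weight_eq_equivPair factorNorm_one i w, Nat.add_lt_add_iff_right] at hsu
  rw [hsw, hw, Word.weight_of_smul factorNorm_one,
    Word.weight_eq_equivPair factorNorm_one j w, Nat.add_lt_add_iff_right] at htu
  have hfst : ∀ {k : Fin d ⊕ Fin e} {n : ℕ}, n < factorNorm k (Word.equivPair k w).head →
      w.fstIdx = some k := fun hlt =>
    Word.fstIdx_eq_of_equivPair_head_ne_one fun h1 => by simp [h1, factorNorm_one] at hlt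
  obtain rfl : i = j := Option.some.inj ((hfst hsu).symm.trans (hfst htu))
  rw [eq_of_factorNorm_mul_lt hs1 ht1 hsu htu]

theorem exists_vinfWeight_mul_lt {u : Vinf d e} (hu : u ≠ 1) :
    ∃ s ∈ stdGen d e, vinfWeight (s * u) < vinfWeight u := by
  classical
  obtain ⟨w, hwu, hw, hsw⟩ := exists_word_weight u
  obtain ⟨i, hi⟩ : ∃ i, (Word.equivPair i w).head ≠ 1 := by
    induction w using Word.consRecOn with
    | empty => exact absurd (hwu.symm.trans Word.prod_empty) hu
    | cons i m w h1 h2 =>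
      refine ⟨i, ?_⟩
      rw [Word.cons_eq_smul, Word.equivPair_smul_same, Word.equivPair_eq_of_fstIdx_ne h1]
      simpa using h2
  obtain ⟨s, hs, hlt⟩ := exists_factorNorm_mul_lt hi
  refine ⟨vinfOf i s, mem_stdGen_iff.mpr ⟨i, s, hs, rfl⟩, ?_⟩
  rw [hsw, hw, Word.weight_of_smul factorNorm_one, Word.weight_eq_equivPair factorNorm_one i w]
  omega

theorem exists_list_stdGen_prod_eq (u : Vinf d e) :
    ∃ l : List (Vinf d e), (∀ s ∈ l, s ∈ stdGen d e) ∧ l.prod = u := by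
  induction h : vinfWeight u using Nat.strong_induction_on generalizing u with
  | _ n ih =>
    by_cases hu : u = 1
    · exact ⟨[], by simp, by simp [hu]⟩
    · obtain ⟨s, hs, hlt⟩ := exists_vinfWeight_mul_lt hu
      obtain ⟨l, hl, hprod⟩ := ih _ (h ▸ hlt) (s * u) rfl
      exact ⟨s⁻¹ :: l, by simpa using ⟨inv_mem_stdGen hs, hl⟩, by simp [hprod]⟩

theorem exists_list_length_eq_wordLen (u : Vinf d e) :
    ∃ l : List (Vinf d e), (∀ s ∈ l, s ∈ stdGen d e) ∧ l.prod = u ∧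
      l.length = wordLen d e u := by
  obtain ⟨l, hl, hprod⟩ := exists_list_stdGen_prod_eq u
  obtain ⟨f, hf, hfu⟩ := Nat.sInf_mem (s := {m : ℕ | ∃ f : Fin m → Vinf d e,
    (∀ s, f s ∈ stdGen d e) ∧ (List.ofFn f).prod = u})
    ⟨l.length, l.get, fun s => hl _ (l.get_mem s), by rw [List.ofFn_get, hprod]⟩
  exact ⟨List.ofFn f, by simpa [List.mem_ofFn] using hf, hfu, List.length_ofFn⟩

end VinfWeight

/-- The left Cayley graph of `V∞` with respect to the standard generators. -/
def cayleyTree (d e : ℕ) : SimpleGraph (Vinf d e) where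
  Adj u v := ∃ s ∈ stdGen d e, v = s * u
  symm := ⟨by rintro u v ⟨s, hs, rfl⟩; exact ⟨s⁻¹, inv_mem_stdGen hs, by simp⟩⟩
  loopless := ⟨by rintro u ⟨s, hs, h⟩; exact vinfWeight_mul_ne hs u (congrArg _ h.symm)⟩

section CayleyTree

variable {d e : ℕ}

theorem isAcyclic_cayleyTree : (cayleyTree d e).IsAcyclic := by
  refine SimpleGraph.isAcyclic_of_height vinfWeight ?_ ?_
  · rintro u v ⟨s, hs, rfl⟩
    exact (vinfWeight_mul_ne hs u).symm
  · rintro u v w ⟨s, hs, rfl⟩ ⟨t, ht, rfl⟩ hsu htu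
    rw [eq_of_vinfWeight_mul_lt hs ht hsu htu]

/-- Reading a word in the generators from right to left gives a walk through its suffixes. -/
theorem exists_walk_suffixes {l : List (Vinf d e)} (hl : ∀ s ∈ l, s ∈ stdGen d e)
    (x : Vinf d e) : ∃ p : (cayleyTree d e).Walk (l.prod * x) x,
      ∀ v ∈ p.support, ∃ l', l' <:+ l ∧ v = l'.prod * x := by
  induction l with
  | nil =>
    rw [List.prod_nil, one_mul]
    exact ⟨SimpleGraph.Walk.nil, fun v hv => ⟨[], List.suffix_rfl, by simpa using hv⟩⟩
  | cons s l ih =>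
    obtain ⟨p, hp⟩ := ih fun t ht => hl t (List.mem_cons_of_mem _ ht)
    have hadj : (cayleyTree d e).Adj ((s :: l).prod * x) (l.prod * x) :=
      ⟨s⁻¹, inv_mem_stdGen (hl s List.mem_cons_self), by simp [mul_assoc]⟩
    refine ⟨SimpleGraph.Walk.cons hadj p, fun v hv => ?_⟩
    rw [SimpleGraph.Walk.support_cons, List.mem_cons] at hv
    rcases hv with rfl | hv
    · exact ⟨s :: l, List.suffix_rfl, rfl⟩
    · obtain ⟨l', hl', rfl⟩ := hp v hv
      exact ⟨l', hl'.trans (List.suffix_cons s l), rfl⟩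

theorem isTree_cayleyTree : (cayleyTree d e).IsTree := by
  have hreach : ∀ u : Vinf d e, (cayleyTree d e).Reachable u 1 := fun u => by
    obtain ⟨l, hl, rfl⟩ := exists_list_stdGen_prod_eq u
    obtain ⟨p, -⟩ := exists_walk_suffixes hl 1
    exact ⟨p.copy (mul_one _) rfl⟩
  have : Nonempty (Vinf d e) := ⟨1⟩
  exact ⟨⟨fun u v => (hreach u).trans (hreach v).symm⟩, isAcyclic_cayleyTree⟩

/-- Every finite set `A` of group elements lies in a set `C` of at most `1 + ∑ ℓ_S(g)` elements
each of which is joined to the identity inside `C`, uniformly over right translates. -/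
theorem exists_suffixClosed_finset (A : Finset (Vinf d e)) :
    ∃ C : Finset (Vinf d e), 1 ∈ C ∧ A ⊆ C ∧ C.card ≤ (∑ g ∈ A, wordLen d e g) + 1 ∧
      ∀ c ∈ C, ∀ x, ∃ p : (cayleyTree d e).Walk (c * x) x, ∀ v ∈ p.support, v * x⁻¹ ∈ C := by
  classical
  choose l hl hprod hlen using exists_list_length_eq_wordLen (d := d) (e := e)
  let C : Finset (Vinf d e) := insert 1
    (A.biUnion fun g => (Finset.range (wordLen d e g)).image fun j => ((l g).drop j).prod)
  have hsuf : ∀ g ∈ A, ∀ l', l' <:+ l g → l'.prod ∈ C := by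
    intro g hg l' hl'
    rw [List.suffix_iff_eq_drop] at hl'
    rcases Nat.eq_zero_or_pos l'.length with h0 | hpos
    · rw [List.length_eq_zero_iff.mp h0]
      exact Finset.mem_insert_self _ _
    · by_cases hw : (l g).length - l'.length < wordLen d e g
      · refine Finset.mem_insert_of_mem (Finset.mem_biUnion.mpr ⟨g, hg, Finset.mem_image.mpr
          ⟨_, Finset.mem_range.mpr hw, ?_⟩⟩)
        rw [← hl']
      · rw [hl', List.drop_eq_nil_of_le (by have := hlen g; omega)]
        exact Finset.mem_insert_self _ _
  refine ⟨C, Finset.mem_insert_self _ _, fun g hg => ?_, ?_, ?_⟩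
  · simpa [hprod] using hsuf g hg _ List.suffix_rfl
  · refine (Finset.card_insert_le _ _).trans (Nat.add_le_add_right
      (Finset.card_biUnion_le.trans (Finset.sum_le_sum fun g _ => ?_)) 1)
    simpa using Finset.card_image_le (s := Finset.range (wordLen d e g))
      (f := fun j => ((l g).drop j).prod)
  · intro c hc x
    rcases Finset.mem_insert.mp hc with rfl | hc
    · exact ⟨SimpleGraph.Walk.nil.copy (one_mul x).symm rfl, by simp [C]⟩
    · obtain ⟨g, hg, hc⟩ := Finset.mem_biUnion.mp hc
      obtain ⟨j, -, rfl⟩ := Finset.mem_image.mp hc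
      obtain ⟨p, hp⟩ := exists_walk_suffixes
        (fun s hs => hl g s (List.mem_of_mem_drop hs) : ∀ s ∈ (l g).drop j, s ∈ stdGen d e) x
      refine ⟨p, fun v hv => ?_⟩
      obtain ⟨l', hl', rfl⟩ := hp v hv
      simpa using hsuf g hg l' (hl'.trans (List.drop_suffix j _))

end CayleyTree

/-- Finite treewidth of extension graphs of `∞`-lifts: with
`m = ∑_{g ∈ supp a} ℓ_S(g)`, the extension graph `X(a)` admits a tree decomposition all of whose
bags have at most `(m+1)·r` vertices. -/
theorem stmt_13 (d e r : ℕ) (hr : 1 ≤ r)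
    (a : Vinf d e → Matrix (Fin r) (Fin r) ℂ)
    (hfin : {g : Vinf d e | a g ≠ 0}.Finite)
    (hsa : ∀ g : Vinf d e, a g⁻¹ = (a g)ᴴ) :
    ∃ (β : Type) (𝒯 : SimpleGraph β) (W : β → Finset (Vinf d e × Fin r)),
      𝒯.IsTree ∧
      (∀ x : Vinf d e × Fin r, ∃ t : β, x ∈ W t) ∧
      (∀ x y : Vinf d e × Fin r, (extGraph d e r a).Adj x y → ∃ t : β, x ∈ W t ∧ y ∈ W t) ∧
      (∀ (x : Vinf d e × Fin r) (t₁ t₂ : β), x ∈ W t₁ → x ∈ W t₂ →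
        ∀ p : 𝒯.Walk t₁ t₂, p.IsPath → ∀ t ∈ p.support, x ∈ W t) ∧
      (∀ t : β, (W t).card ≤ ((∑ g ∈ hfin.toFinset, wordLen d e g) + 1) * r) := by
  classical
  obtain ⟨C, hone, hAC, hcard, hwalk⟩ := exists_suffixClosed_finset hfin.toFinset
  let W : Vinf d e → Finset (Vinf d e × Fin r) := fun t =>
    (C.image fun c => c⁻¹ * t) ×ˢ Finset.univ
  have hW : ∀ t x, x ∈ W t ↔ t * x.1⁻¹ ∈ C := by
    intro t x
    simp only [W, Finset.mem_product, Finset.mem_image, Finset.mem_univ, and_true]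
    constructor
    · rintro ⟨c, hc, hx⟩
      simpa [← hx] using hc
    · exact fun h => ⟨_, h, by simp⟩
  have hself : ∀ x, x ∈ W x.1 := fun x => (hW _ _).mpr (by simpa using hone)
  have hrel : ∀ x y : Vinf d e × Fin r, a (y.1 * x.1⁻¹) y.2 x.2 ≠ 0 → x ∈ W y.1 := by
    intro x y h
    refine (hW _ _).mpr (hAC (hfin.mem_toFinset.mpr fun h0 => h ?_))
    rw [h0, Matrix.zero_apply]
  refine ⟨Vinf d e, cayleyTree d e, W, isTree_cayleyTree, fun x => ⟨x.1, hself x⟩, ?_, ?_, ?_⟩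
  · rintro x y ⟨-, h | h⟩
    · exact ⟨y.1, hrel x y h, hself y⟩
    · exact ⟨x.1, hself x, hrel y x h⟩
  · intro x t₁ t₂ h₁ h₂ p hp t ht
    obtain ⟨q₁, hq₁⟩ := hwalk _ ((hW _ _).mp h₁) x.1
    obtain ⟨q₂, hq₂⟩ := hwalk _ ((hW _ _).mp h₂) x.1
    have hmem := isAcyclic_cayleyTree.support_subset_of_isPath hp
      ((q₁.append q₂.reverse).copy (by simp) (by simp)) ht
    rw [SimpleGraph.Walk.support_copy, SimpleGraph.Walk.mem_support_append_iff,
      SimpleGraph.Walk.support_reverse, List.mem_reverse] at hmem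
    exact (hW _ _).mpr (hmem.elim (hq₁ t) (hq₂ t))
  · intro t
    rw [Finset.card_product, Finset.card_univ, Fintype.card_fin]
    exact Nat.mul_le_mul_right r (Finset.card_image_le.trans hcard)
end

section
/- Let V∞ be the free product of d copies of ℤ/2ℤ and e copies of ℤ, let r ≥ 1, and let a : V∞ → Matrix (Fin r) (Fin r) ℂ be finitely supported and self-adjoint. Then every connected component of the extension graph X(a) is Gromov hyperbolic for the graph metric, with a hyperbolicity constant depending only on a: there exists δ ∈ ℕ such that for all vertices p, q, s of X(a) that are pairwise reachable in X(a), for every path P from p to q of length dist(p,q), every path Q from p to s of length dist(p,s), and every path R from q to s of length dist(q,s), and every vertex x lying on P, there exists a vertex y lying on Q or on R with dist(x,y) ≤ δ. Here dist denotes the graph distance (SimpleGraph.dist) in X(a). -/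
open Matrix

namespace SimpleGraph

variable {V W : Type*} {G : SimpleGraph V} {H : SimpleGraph W}

lemma Iso.dist_map_le (f : G ≃g H) (x y : V) : H.dist (f x) (f y) ≤ G.dist x y := by
  by_cases h : G.Reachable x y
  · obtain ⟨w, hw⟩ := h.exists_walk_length_eq_dist
    rw [← hw, ← w.length_map f.toHom]
    exact dist_le _
  · rw [dist_eq_zero_of_not_reachable (mt f.reachable_iff.mp h)]
    exact Nat.zero_le _

/-- On a geodesic, a vertex between `y` and `z` is no further from `y` than `z` is. -/
lemma Walk.dist_le_dist_of_mem_append {p x q y z : V} (A : G.Walk p x) (B : G.Walk x q)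
    (h : (A.append B).length = G.dist p q) (hy : y ∈ A.support) (hz : z ∈ B.support) :
    G.dist y x ≤ G.dist y z := by
  classical
  have hA := congrArg Walk.length (A.take_spec hy)
  have hB := congrArg Walk.length (B.take_spec hz)
  rw [Walk.length_append] at h hA hB
  obtain ⟨w, hw⟩ :=
    ((A.dropUntil y hy).append (B.takeUntil z hz)).reachable.exists_walk_length_eq_dist
  have h₁ := dist_le ((A.takeUntil y hy).append (w.append (B.dropUntil z hz)))
  simp only [Walk.length_append] at h₁
  have h₂ := dist_le (A.dropUntil y hy)
  omega

/-- If a function on the vertices takes different values at the ends of a walk, then it changes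
across some edge of the walk. -/
lemma Walk.exists_adj_ne {α : Type*} (f : V → α) {p q : V} (w : G.Walk p q) (h : f p ≠ f q) :
    ∃ x ∈ w.support, ∃ y, G.Adj x y ∧ f x ≠ f y := by
  induction w with
  | nil => exact absurd rfl h
  | @cons u v _ huv w ih =>
    by_cases huv' : f u = f v
    · obtain ⟨x, hx, hxy⟩ := ih (huv' ▸ h)
      exact ⟨x, by simp [hx], hxy⟩
    · exact ⟨u, by simp, v, huv, huv'⟩

end SimpleGraph

namespace Vinf

/-- The letters of reduced words in `Vinf d e`: one involution for each copy of `ℤ/2ℤ`, and a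
generator (`true`) and its inverse (`false`) for each copy of `ℤ`. -/
abbrev Letter (d e : ℕ) : Type := Fin d ⊕ Fin e × Bool

variable {d e : ℕ}

/-- The formal inverse of a letter. -/
def Letter.inv : Letter d e → Letter d e
  | .inl i => .inl i
  | .inr (i, b) => .inr (i, !b)

lemma Letter.inv_inv (a : Letter d e) : a.inv.inv = a := by
  rcases a with i | ⟨i, b⟩ <;> simp [Letter.inv]

/-- A word is reduced if no letter is followed by its formal inverse. -/
def Reduced (l : List (Letter d e)) : Prop := l.IsChain fun a b => b ≠ a.inv

/-- Left multiplication of a reduced word by a letter. -/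
def push (a : Letter d e) : List (Letter d e) → List (Letter d e)
  | [] => [a]
  | b :: t => if b = a.inv then t else a :: b :: t

lemma Reduced.push {l : List (Letter d e)} (hl : Reduced l) (a : Letter d e) :
    Reduced (push a l) := by
  unfold Reduced at *
  cases l with
  | nil => simp [Vinf.push]
  | cons b t =>
    by_cases hb : b = a.inv
    · simpa [Vinf.push, hb] using hl.tail
    · simp [Vinf.push, hb, hl]

lemma Reduced.push_inv_push {l : List (Letter d e)} (hl : Reduced l) (a : Letter d e) :
    Vinf.push a.inv (Vinf.push a l) = l := by
  cases l with
  | nil => simp [Vinf.push, Letter.inv_inv]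
  | cons b t =>
    by_cases hb : b = a.inv
    · subst hb
      cases t with
      | nil => simp [Vinf.push]
      | cons c t =>
        have hc : c ≠ a := by
          have := (List.isChain_cons_cons.mp hl).1
          rwa [Letter.inv_inv] at this
        simp [Vinf.push, Letter.inv_inv, hc]
    · simp [Vinf.push, hb, Letter.inv_inv]

lemma length_push_le (a : Letter d e) (l : List (Letter d e)) :
    (push a l).length ≤ l.length + 1 := by
  rcases l with _ | ⟨b, t⟩
  · rfl
  · by_cases hb : b = a.inv
    · simp only [push, hb, if_true, List.length_cons]
      omega
    · simp [push, hb]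

lemma getLast?_push {a : Letter d e} {l : List (Letter d e)} (h : l.getLast? ≠ none)
    (h' : (push a l).getLast? ≠ none) : (push a l).getLast? = l.getLast? := by
  rcases l with _ | ⟨b, _ | ⟨c, t⟩⟩
  · exact absurd rfl h
  · by_cases hb : b = a.inv <;> simp_all [push]
  · by_cases hb : b = a.inv <;> simp [push, hb]

lemma push_of_reduced_cons {a : Letter d e} {t : List (Letter d e)} (h : Reduced (a :: t)) :
    push a t = a :: t := by
  cases t with
  | nil => rfl
  | cons b t => simp [push, (List.isChain_cons_cons.mp h).1]

/-- Left multiplication by a letter as a permutation of the reduced words. -/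
def pushPerm (a : Letter d e) : Equiv.Perm {l : List (Letter d e) // Reduced l} where
  toFun l := ⟨push a l.1, l.2.push a⟩
  invFun l := ⟨push a.inv l.1, l.2.push a.inv⟩
  left_inv l := Subtype.ext (l.2.push_inv_push a)
  right_inv l := Subtype.ext <| by simpa [Letter.inv_inv] using l.2.push_inv_push a.inv

lemma pushPerm_inv (a : Letter d e) : pushPerm a.inv = (pushPerm a)⁻¹ :=
  Equiv.ext fun _ => rfl

/-- The homomorphism from `ℤ/2ℤ` determined by an involution. -/
def involutionHom {K : Type*} [Group K] (k : K) (hk : k * k = 1) :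
    Multiplicative (ZMod 2) →* K where
  toFun m := if m = 1 then 1 else k
  map_one' := by simp
  map_mul' x y := by
    have h : ∀ z : Multiplicative (ZMod 2), z = 1 ∨ z = Multiplicative.ofAdd 1 := by decide
    have h₁ : Multiplicative.ofAdd (1 : ZMod 2) ≠ 1 := by decide
    have h₂ : Multiplicative.ofAdd (1 : ZMod 2) * Multiplicative.ofAdd (1 : ZMod 2) = 1 := by
      decide
    rcases h x with rfl | rfl <;> rcases h y with rfl | rfl <;>
      simp only [one_mul, mul_one, h₁, h₂, hk, if_true, if_false]

lemma involutionHom_ofAdd_one {K : Type*} [Group K] (k : K) (hk : k * k = 1) :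
    involutionHom k hk (Multiplicative.ofAdd 1) = k :=
  if_neg (t := (1 : K)) (by decide : (Multiplicative.ofAdd 1 : Multiplicative (ZMod 2)) ≠ 1)

/-- The action of `Vinf d e` on reduced words. -/
def wordAction (d e : ℕ) : Vinf d e →* Equiv.Perm {l : List (Letter d e) // Reduced l} :=
  Monoid.CoprodI.lift (M := Gfam d e) fun i => match i with
    | .inl i => involutionHom (pushPerm (.inl i)) <| by
        conv_lhs => rw [← inv_inv (pushPerm (.inl i)), ← pushPerm_inv]
        exact inv_mul_cancel _
    | .inr i => zpowersHom _ (pushPerm (.inr (i, true)))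

/-- The inclusion of the `i`-th copy of `ℤ/2ℤ`. -/
def ofInl (i : Fin d) : Multiplicative (ZMod 2) →* Vinf d e :=
  Monoid.CoprodI.of (M := Gfam d e) (i := .inl i)

/-- The inclusion of the `i`-th copy of `ℤ`. -/
def ofInr (i : Fin e) : Multiplicative ℤ →* Vinf d e :=
  Monoid.CoprodI.of (M := Gfam d e) (i := .inr i)

/-- The group element represented by a letter. -/
def ofLetter : Letter d e → Vinf d e
  | .inl i => ofInl i (Multiplicative.ofAdd 1)
  | .inr (i, true) => ofInr i (Multiplicative.ofAdd 1)
  | .inr (i, false) => (ofInr i (Multiplicative.ofAdd 1))⁻¹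

lemma ofLetter_inv (a : Letter d e) : ofLetter a.inv = (ofLetter a)⁻¹ := by
  rcases a with i | ⟨i, _ | _⟩
  · rw [eq_inv_iff_mul_eq_one]
    change ofInl i _ * ofInl i _ = 1
    rw [← map_mul, ← map_one (ofInl i)]
    congr 1
  · exact (inv_inv _).symm
  · rfl

lemma wordAction_ofLetter (a : Letter d e) : wordAction d e (ofLetter a) = pushPerm a := by
  have key (i : Fin e) : wordAction d e (ofInr i (Multiplicative.ofAdd 1)) =
      pushPerm (.inr (i, true)) := by
    refine (Monoid.CoprodI.lift_of (M := Gfam d e) _ _).trans ?_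
    exact (zpowersHom_apply _ (pushPerm (.inr (i, true))) (Multiplicative.ofAdd 1)).trans
      (zpow_one _)
  rcases a with i | ⟨i, _ | _⟩
  · refine (Monoid.CoprodI.lift_of (M := Gfam d e) _ _).trans ?_
    exact involutionHom_ofAdd_one _ _
  · exact (map_inv _ _).trans ((congrArg _ (key i)).trans (pushPerm_inv (.inr (i, true))).symm)
  · exact key i

lemma closure_range_ofLetter : Subgroup.closure (Set.range (ofLetter (d := d) (e := e))) = ⊤ := by
  rw [eq_top_iff]
  rintro g -
  have hmem (a : Letter d e) : ofLetter a ∈ Subgroup.closure (Set.range (ofLetter (d := d))) :=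
    Subgroup.subset_closure ⟨a, rfl⟩
  induction g using Monoid.CoprodI.induction_on (M := Gfam d e) with
  | one => exact one_mem _
  | mul x y hx hy => exact mul_mem hx hy
  | of i m =>
    rcases i with i | i
    · have h : ∀ z : Multiplicative (ZMod 2), z = 1 ∨ z = Multiplicative.ofAdd 1 := by decide
      rcases h m with h | h
      · rw [show Monoid.CoprodI.of m = (1 : Vinf d e) from (congrArg (ofInl i) h).trans (map_one _)]
        exact one_mem _
      · rw [h]
        exact hmem (.inl i)
    · have h : Monoid.CoprodI.of m =
          ofLetter (d := d) (.inr (i, true)) ^ Multiplicative.toAdd (α := ℤ) m := by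
        change ofInr i m = ofInr i _ ^ _
        rw [← map_zpow, ← Int.ofAdd_mul, one_mul]
        rfl
      rw [h]
      exact zpow_mem (hmem _) _

/-- The reduced word representing a group element. -/
def word (g : Vinf d e) : List (Letter d e) := (wordAction d e g ⟨[], List.isChain_nil⟩).1

/-- The group element represented by a word. -/
def eval (l : List (Letter d e)) : Vinf d e := (l.map ofLetter).prod

lemma word_reduced (g : Vinf d e) : Reduced (word g) :=
  (wordAction d e g ⟨[], List.isChain_nil⟩).2

lemma word_one : word (1 : Vinf d e) = [] := by simp [word]

lemma word_ofLetter_mul (a : Letter d e) (g : Vinf d e) :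
    word (ofLetter a * g) = push a (word g) := by
  simp [word, wordAction_ofLetter, pushPerm]

lemma eval_push (a : Letter d e) (l : List (Letter d e)) :
    eval (push a l) = ofLetter a * eval l := by
  cases l with
  | nil => rfl
  | cons b t =>
    by_cases hb : b = a.inv
    · simp [push, eval, hb, ofLetter_inv]
    · simp [push, eval, hb]

lemma eval_wordAction (g : Vinf d e) (l : {l : List (Letter d e) // Reduced l}) :
    eval (wordAction d e g l).1 = g * eval l.1 := by
  have hg : g ∈ Subgroup.closure (Set.range (ofLetter (d := d) (e := e))) := by
    simp [closure_range_ofLetter]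
  induction hg using Subgroup.closure_induction generalizing l with
  | mem x hx =>
    obtain ⟨a, rfl⟩ := hx
    rw [wordAction_ofLetter]
    exact eval_push a l.1
  | one => simp
  | mul x y _ _ hx hy => rw [map_mul, Equiv.Perm.mul_apply, hx, hy, mul_assoc]
  | inv x _ hx =>
    rw [eq_inv_mul_iff_mul_eq, ← hx, ← Equiv.Perm.mul_apply, ← map_mul, mul_inv_cancel, map_one,
      Equiv.Perm.one_apply]

lemma eval_word (g : Vinf d e) : eval (word g) = g :=
  (eval_wordAction g _).trans (mul_one g)

lemma word_eval {l : List (Letter d e)} (hl : Reduced l) : word (eval l) = l := by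
  induction l with
  | nil => exact word_one
  | cons a t ih =>
    rw [show eval (a :: t) = ofLetter a * eval t from List.prod_cons, word_ofLetter_mul,
      ih hl.tail, push_of_reduced_cons hl]

lemma length_word_eval_le (l : List (Letter d e)) : (word (eval l)).length ≤ l.length := by
  induction l with
  | nil => exact (congrArg List.length word_one).le
  | cons a t ih =>
    rw [show eval (a :: t) = ofLetter a * eval t from List.prod_cons, word_ofLetter_mul]
    exact (length_push_le a _).trans (Nat.succ_le_succ ih)

lemma eval_append (l l' : List (Letter d e)) : eval (l ++ l') = eval l * eval l' := by
  simp [eval]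

lemma eval_singleton (a : Letter d e) : eval [a] = ofLetter a := by simp [eval]

lemma length_word_mul_ofLetter_le (g : Vinf d e) (a : Letter d e) :
    (word (g * ofLetter a)).length ≤ (word g).length + 1 := by
  have h := length_word_eval_le (word g ++ [a])
  rwa [eval_append, eval_word, eval_singleton, List.length_append] at h

/-- The last letter of the reduced word of a group element. -/
def lastLetter (g : Vinf d e) : Option (Letter d e) := (word g).getLast?

lemma lastLetter_eq_none {g : Vinf d e} : lastLetter g = none ↔ g = 1 := by
  rw [lastLetter, List.getLast?_eq_none_iff]
  refine ⟨fun h => ?_, fun h => h ▸ word_one⟩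
  rw [← eval_word g, h]
  rfl

lemma length_word_mul_inv_lastLetter {g : Vinf d e} {a : Letter d e}
    (h : lastLetter g = some a) : (word (g * (ofLetter a)⁻¹)).length + 1 = (word g).length := by
  obtain ⟨l, hl⟩ := List.getLast?_eq_some_iff.mp h
  have hr : Reduced l := (hl ▸ word_reduced g : Reduced (l ++ [a])).left_of_append
  have hg : g = eval l * ofLetter a := by rw [← eval_word g, hl, eval_append, eval_singleton]
  rw [hl, hg, mul_inv_cancel_right, word_eval hr, List.length_append, List.length_singleton]

/-- Any three elements have a median. -/
lemma exists_median (u v w : Vinf d e) : ∃ m : Vinf d e,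
    (lastLetter (u * m⁻¹) = lastLetter (v * m⁻¹) → u = m) ∧
    (lastLetter (u * m⁻¹) = lastLetter (w * m⁻¹) → u = m) ∧
    (lastLetter (v * m⁻¹) = lastLetter (w * m⁻¹) → v = m) := by
  let f : Vinf d e → ℕ := fun m =>
    (word (u * m⁻¹)).length + (word (v * m⁻¹)).length + (word (w * m⁻¹)).length
  obtain ⟨m, hm⟩ : ∃ m, ∀ m', f m ≤ f m' :=
    ⟨Function.argmin f, fun m' => Function.argmin_le f m'⟩
  have hinv (a : Letter d e) (x : Vinf d e) :
      x * (ofLetter a * m)⁻¹ = x * m⁻¹ * (ofLetter a)⁻¹ := by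
    rw [_root_.mul_inv_rev, mul_assoc]
  have hle (a : Letter d e) (x : Vinf d e) :
      (word (x * (ofLetter a * m)⁻¹)).length ≤ (word (x * m⁻¹)).length + 1 := by
    rw [hinv, ← ofLetter_inv]
    exact length_word_mul_ofLetter_le _ _
  have hlt {a : Letter d e} {x : Vinf d e} (h : lastLetter (x * m⁻¹) = some a) :
      (word (x * (ofLetter a * m)⁻¹)).length + 1 = (word (x * m⁻¹)).length := by
    rw [hinv]
    exact length_word_mul_inv_lastLetter h
  have heq {x : Vinf d e} (h : lastLetter (x * m⁻¹) = none) : x = m :=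
    mul_inv_eq_one.mp (lastLetter_eq_none.mp h)
  refine ⟨m, fun h => ?_, fun h => ?_, fun h => ?_⟩
  · rcases hu : lastLetter (u * m⁻¹) with _ | a
    · exact heq hu
    · have h₁ := hm (ofLetter a * m)
      have h₂ := hlt hu
      have h₃ := hlt (h.symm.trans hu)
      have h₄ := hle a w
      simp only [f] at h₁
      omega
  · rcases hu : lastLetter (u * m⁻¹) with _ | a
    · exact heq hu
    · have h₁ := hm (ofLetter a * m)
      have h₂ := hlt hu
      have h₃ := hlt (h.symm.trans hu)
      have h₄ := hle a v
      simp only [f] at h₁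
      omega
  · rcases hv : lastLetter (v * m⁻¹) with _ | a
    · exact heq hv
    · have h₁ := hm (ofLetter a * m)
      have h₂ := hlt hv
      have h₃ := hlt (h.symm.trans hv)
      have h₄ := hle a u
      simp only [f] at h₁
      omega

/-- Left multiplication by a fixed element changes the last letter of only finitely many
elements. -/
lemma finite_lastLetter_mul_ne (g : Vinf d e) :
    {x : Vinf d e | lastLetter (g * x) ≠ lastLetter x}.Finite := by
  have hg : g ∈ Subgroup.closure (Set.range (ofLetter (d := d) (e := e))) := by
    simp [closure_range_ofLetter]
  induction hg using Subgroup.closure_induction with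
  | mem x hx =>
    obtain ⟨a, rfl⟩ := hx
    refine (Set.toFinite {1, (ofLetter a)⁻¹}).subset fun x hx => ?_
    by_contra hx'
    simp only [Set.mem_insert_iff, Set.mem_singleton_iff, not_or, ← mul_eq_one_iff_eq_inv'] at hx'
    have h₁ := mt lastLetter_eq_none.mp hx'.1
    have h₂ := mt lastLetter_eq_none.mp hx'.2
    refine hx ?_
    rw [lastLetter, word_ofLetter_mul] at h₂ ⊢
    rw [lastLetter] at h₁ ⊢
    exact getLast?_push h₁ h₂
  | one => simp
  | mul g h _ _ hg hh =>
    refine (hh.union (hg.preimage (mul_right_injective h).injOn)).subset fun x hx => ?_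
    by_contra hx'
    simp only [Set.mem_union, Set.mem_preimage, Set.mem_ofPred_eq, not_or, not_not] at hx'
    exact hx (by rw [mul_assoc, hx'.2, hx'.1])
  | inv g _ hg =>
    refine (hg.preimage (mul_right_injective g⁻¹).injOn).subset fun x hx => ?_
    simpa [eq_comm] using hx

end Vinf

open Vinf

section extGraph

variable {d e r : ℕ} {a : Vinf d e → Matrix (Fin r) (Fin r) ℂ}

/-- Right translation is an automorphism of the extension graph. -/
def extGraphTranslate (a : Vinf d e → Matrix (Fin r) (Fin r) ℂ) (c : Vinf d e) :
    extGraph d e r a ≃g extGraph d e r a where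
  toEquiv := (Equiv.mulRight c).prodCongr (Equiv.refl _)
  map_rel_iff' := by
    rintro ⟨u, i⟩ ⟨v, j⟩
    simp [extGraph, mul_assoc]

/-- Vertices at bounded displacement in the group are at bounded distance in the extension
graph. -/
lemma exists_dist_le_of_finite (a : Vinf d e → Matrix (Fin r) (Fin r) ℂ)
    {K : Set (Vinf d e)} (hK : K.Finite) :
    ∃ C : ℕ, ∀ x y : Vinf d e × Fin r, x.1 * y.1⁻¹ ∈ K → (extGraph d e r a).dist x y ≤ C := by
  obtain ⟨C, hC⟩ := ((hK.prod (Set.finite_univ (α := Fin r × Fin r))).image fun t =>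
    (extGraph d e r a).dist (t.1, t.2.1) (1, t.2.2)).bddAbove
  refine ⟨C, fun x y hxy => ?_⟩
  have h := (extGraphTranslate a y.1).dist_map_le (x.1 * y.1⁻¹, x.2) (1, y.2)
  simp only [extGraphTranslate, RelIso.coe_fn_mk, Equiv.prodCongr_apply, Prod.map,
    Equiv.coe_mulRight, inv_mul_cancel_right, one_mul, Equiv.refl_apply] at h
  exact h.trans (hC ⟨(x.1 * y.1⁻¹, x.2, y.2), ⟨hxy, trivial⟩, rfl⟩)

/-- A finite set whose translates block every walk between vertices which are separated by a
point of the group. -/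
lemma exists_finite_separator (hfin : {g : Vinf d e | a g ≠ 0}.Finite) :
    ∃ B : Set (Vinf d e), B.Finite ∧ ∀ (m : Vinf d e) (p q : Vinf d e × Fin r)
      (w : (extGraph d e r a).Walk p q),
      (lastLetter (p.1 * m⁻¹) = lastLetter (q.1 * m⁻¹) → p.1 = m) →
      ∃ x ∈ w.support, x.1 * m⁻¹ ∈ B := by
  let S := {g : Vinf d e | a g ≠ 0} ∪ {g : Vinf d e | a g ≠ 0}⁻¹
  have hS : S.Finite := hfin.union hfin.inv
  refine ⟨insert 1 (⋃ g ∈ S, {x : Vinf d e | lastLetter (g * x) ≠ lastLetter x}),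
    (hS.biUnion fun g _ => finite_lastLetter_mul_ne g).insert _, fun m p q w h => ?_⟩
  by_cases hpq : lastLetter (p.1 * m⁻¹) = lastLetter (q.1 * m⁻¹)
  · exact ⟨p, w.start_mem_support, .inl (by rw [h hpq, mul_inv_cancel])⟩
  · obtain ⟨x, hx, y, hxy, hne⟩ :=
      w.exists_adj_ne (fun x : Vinf d e × Fin r => lastLetter (x.1 * m⁻¹)) hpq
    refine ⟨x, hx, .inr (Set.mem_biUnion (x := y.1 * x.1⁻¹) ?_ ?_)⟩
    · rw [extGraph, SimpleGraph.fromRel_adj] at hxy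
      rcases hxy.2 with h | h
      · exact .inl fun h₀ => h (by rw [h₀]; rfl)
      · refine .inr fun h₀ => h ?_
        rw [_root_.mul_inv_rev, inv_inv] at h₀
        rw [h₀]; rfl
    · simpa [mul_assoc, eq_comm] using hne

end extGraph

/-- Hyperbolicity of the connected components of extension graphs of
`∞`-lifts: there is a constant `δ` (depending only on `a`) such that for all pairwise-reachable
vertices `p, q, s` and all geodesics `P : p→q`, `Q : p→s`, `R : q→s`, every vertex on `P` is
within graph distance `δ` of a vertex of `Q` or `R` (thin-triangles condition). -/
theorem stmt_15 (d e r : ℕ) (hr : 1 ≤ r)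
    (a : Vinf d e → Matrix (Fin r) (Fin r) ℂ)
    (hfin : {g : Vinf d e | a g ≠ 0}.Finite)
    (hsa : ∀ g : Vinf d e, a g⁻¹ = (a g)ᴴ) :
    ∃ δ : ℕ, ∀ (p q s : Vinf d e × Fin r)
      (P : (extGraph d e r a).Walk p q) (Q : (extGraph d e r a).Walk p s)
      (R : (extGraph d e r a).Walk q s),
      P.length = (extGraph d e r a).dist p q →
      Q.length = (extGraph d e r a).dist p s →
      R.length = (extGraph d e r a).dist q s →
      ∀ x ∈ P.support, ∃ y : Vinf d e × Fin r,
        (y ∈ Q.support ∨ y ∈ R.support) ∧ (extGraph d e r a).dist x y ≤ δ := by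
  classical
  obtain ⟨B, hB, hsep⟩ := exists_finite_separator hfin
  obtain ⟨C, hC⟩ := exists_dist_le_of_finite a (hB.mul hB.inv)
  have hBC (m : Vinf d e) (x y : Vinf d e × Fin r) (hx : x.1 * m⁻¹ ∈ B) (hy : y.1 * m⁻¹ ∈ B) :
      (extGraph d e r a).dist x y ≤ C :=
    hC x y ⟨_, hx, _, Set.inv_mem_inv.mpr hy, by simp⟩
  refine ⟨C + C, fun p q s P Q R hP _ _ x hx => ?_⟩
  obtain ⟨m, hpx, hpq, hxq⟩ := exists_median p.1 x.1 q.1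
  obtain ⟨y, hy, hyB⟩ := hsep m p x (P.takeUntil x hx) hpx
  obtain ⟨z, hz, hzB⟩ := hsep m x q (P.dropUntil x hx) hxq
  obtain ⟨t, ht, htB⟩ := hsep m p q (Q.append R.reverse) hpq
  refine ⟨t, by simpa using ht, ?_⟩
  have hyx : (extGraph d e r a).dist y x ≤ C :=
    (SimpleGraph.Walk.dist_le_dist_of_mem_append _ _ (by rw [P.take_spec hx, hP]) hy hz).trans
      (hBC m y z hyB hzB)
  have hreach : (extGraph d e r a).Reachable x y :=
    ((P.takeUntil x hx).dropUntil y hy).reachable.symm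
  refine (hreach.dist_triangle_left t).trans (add_le_add ?_ (hBC m y t hyB htB))
  rwa [SimpleGraph.dist_comm]
end
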